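/- arXiv:0804.1388 — 2 statements merged into one kernel-verified Lean document; each statement's English description precedes it below -/
import Mathlib

section
/- Let 𝒩 be a nest on an infinite-dimensional separable complex Hilbert space H. Then: (a) if Rg_n(T(𝒩)) is dense in T(𝒩)^n for some n ≥ 1, then Rg_2(T(𝒩)) is dense in T(𝒩)^2 and Rg_1(T(𝒩)) is not dense in T(𝒩) (rtsr(T(𝒩)) ∈ {2, ∞}); (b) if Lg_n(T(𝒩)) is dense in T(𝒩)^n for some n ≥ 1, then Lg_2(T(𝒩)) is dense in T(𝒩)^2 and Lg_1(T(𝒩)) is not dense in T(𝒩) (ltsr(T(𝒩)) ∈ {2, ∞}); (c) it is not the case that both Rg_n(T(𝒩)) is dense in T(𝒩)^n for some n and Lg_m(T(𝒩)) is dense in T(𝒩)^m for some m; that is, max{rtsr(T(𝒩)), ltsr(T(𝒩))} = ∞. -/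
/-- A *nest* on a Hilbert space `H`: a family of closed subspaces, totally
ordered by inclusion, containing `{0}` and `H`, closed under arbitrary
intersections and under closed linear spans of subfamilies. -/
structure IsNest {H : Type*} [NormedAddCommGroup H] [InnerProductSpace ℂ H]
    (𝒩 : Set (Submodule ℂ H)) : Prop where
  closed : ∀ N ∈ 𝒩, IsClosed (N : Set H)
  chain : IsChain (· ≤ ·) 𝒩
  bot_mem : (⊥ : Submodule ℂ H) ∈ 𝒩
  top_mem : (⊤ : Submodule ℂ H) ∈ 𝒩
  sInf_mem : ∀ S ⊆ 𝒩, S.Nonempty → sInf S ∈ 𝒩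
  closure_sSup_mem : ∀ S ⊆ 𝒩, S.Nonempty → (sSup S).topologicalClosure ∈ 𝒩

/-- The nest algebra `T(𝒩)` of all bounded operators leaving each element of
the nest invariant. -/
def nestAlg {H : Type*} [NormedAddCommGroup H] [InnerProductSpace ℂ H]
    (𝒩 : Set (Submodule ℂ H)) : Set (H →L[ℂ] H) :=
  {T | ∀ N ∈ 𝒩, ∀ x ∈ N, T x ∈ N}

/-- Density of the right-invertible `n`-tuples `Rg_n(S)` in `S^n`. -/
def RgDenseIn {A : Type*} [NormedRing A] (S : Set A) (n : ℕ) : Prop :=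
  ∀ a : Fin n → A, (∀ i, a i ∈ S) → ∀ ε : ℝ, 0 < ε →
    ∃ b c : Fin n → A, (∀ i, b i ∈ S) ∧ (∀ i, c i ∈ S) ∧
      (∀ i, ‖a i - b i‖ < ε) ∧ ∑ i, b i * c i = 1

/-- Density of the left-invertible `n`-tuples `Lg_n(S)` in `S^n`. -/
def LgDenseIn {A : Type*} [NormedRing A] (S : Set A) (n : ℕ) : Prop :=
  ∀ a : Fin n → A, (∀ i, a i ∈ S) → ∀ ε : ℝ, 0 < ε →
    ∃ b c : Fin n → A, (∀ i, b i ∈ S) ∧ (∀ i, c i ∈ S) ∧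
      (∀ i, ‖a i - b i‖ < ε) ∧ ∑ i, c i * b i = 1

open scoped InnerProductSpace

section EDim

variable {X Y : Type*} [NormedAddCommGroup X] [InnerProductSpace ℂ X]
  [NormedAddCommGroup Y] [InnerProductSpace ℂ Y]

/-- The dimension of a subspace as an extended natural number. -/
noncomputable def edim (S : Submodule ℂ X) : ℕ∞ := Cardinal.toENat (Module.rank ℂ S)

theorem edim_mono {S T : Submodule ℂ X} (h : S ≤ T) : edim S ≤ edim T :=
  OrderHomClass.mono Cardinal.toENat (Submodule.rank_mono h)

theorem edim_lt_top_iff {S : Submodule ℂ X} : edim S < ⊤ ↔ FiniteDimensional ℂ S := by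
  rw [edim, lt_top_iff_ne_top, Ne, Cardinal.toENat_eq_top, not_le, Module.rank_lt_aleph0_iff]

theorem edim_eq_finrank (S : Submodule ℂ X) [FiniteDimensional ℂ S] :
    edim S = Module.finrank ℂ S := by
  rw [edim, ← Module.finrank_eq_rank, Cardinal.toENat_nat]

theorem edim_sup_of_disjoint {S T : Submodule ℂ X} (h : Disjoint S T) :
    edim (S ⊔ T) = edim S + edim T := by
  have := Submodule.rank_sup_add_rank_inf_eq S T
  rw [h.eq_bot, rank_bot, add_zero] at this
  rw [edim, this, map_add, edim, edim]

theorem edim_eq_zero_iff {S : Submodule ℂ X} : edim S = 0 ↔ S = ⊥ := by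
  rw [edim, Cardinal.toENat_eq_zero, rank_zero_iff, Submodule.subsingleton_iff_eq_bot]

theorem exists_hilbertBasis_orthonormal_of_edim_le [CompleteSpace X] [CompleteSpace Y]
    [TopologicalSpace.SeparableSpace X]
    (h : edim (⊤ : Submodule ℂ X) ≤ edim (⊤ : Submodule ℂ Y)) :
    ∃ (w : Set X) (_ : HilbertBasis w ℂ X) (v : w → Y), Orthonormal ℂ v := by
  obtain ⟨w, b, hb⟩ := exists_hilbertBasis ℂ Y
  obtain ⟨w', b', hb'⟩ := exists_hilbertBasis ℂ X
  by_cases hY : FiniteDimensional ℂ Y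
  · have hX : FiniteDimensional ℂ X := by
      have h2 : edim (⊤ : Submodule ℂ X) < ⊤ := h.trans_lt (edim_lt_top_iff.2 inferInstance)
      have := edim_lt_top_iff.1 h2
      exact Module.Finite.equiv (Submodule.topEquiv (R := ℂ) (M := X))
    rw [edim_eq_finrank, edim_eq_finrank, finrank_top, finrank_top, Nat.cast_le] at h
    have hf : Finite w' := b'.orthonormal.linearIndependent.finite
    cases nonempty_fintype w'
    have hc : Fintype.card w' ≤ Module.finrank ℂ X :=
      b'.orthonormal.linearIndependent.fintype_card_le_finrank
    obtain ⟨e⟩ : Nonempty (w' ↪ Fin (Module.finrank ℂ Y)) :=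
      Function.Embedding.nonempty_of_card_le (by simpa using hc.trans h)
    exact ⟨w', b', _, (stdOrthonormalBasis ℂ Y).orthonormal.comp e e.injective⟩
  · have hw : Infinite w := by
      by_contra hfin
      rw [not_infinite_iff_finite] at hfin
      cases nonempty_fintype w
      exact hY (b.toOrthonormalBasis.toBasis.finiteDimensional_of_finite)
    have hcount : Countable w' := by
      have hr : (Set.range b').Countable := by
        have hdisc : ∀ x ∈ Set.range b', ∀ y ∈ Set.range b', x ≠ y → 1 ≤ dist x y := by
          rintro _ ⟨i, rfl⟩ _ ⟨j, rfl⟩ hij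
          have hij' : i ≠ j := fun h => hij (by rw [h])
          have h2 : ‖b' i - b' j‖ * ‖b' i - b' j‖ = 2 := by
            rw [norm_sub_mul_self (𝕜 := ℂ), b'.orthonormal.1 i, b'.orthonormal.1 j,
              b'.orthonormal.2 hij']
            norm_num
          rw [dist_eq_norm]
          nlinarith [norm_nonneg (b' i - b' j)]
        refine Set.PairwiseDisjoint.countable_of_isOpen
          (s := fun x : X => Metric.ball x (1 / 2)) ?_ (fun _ _ => Metric.isOpen_ball)
          (fun x _ => ⟨x, Metric.mem_ball_self (by norm_num)⟩)
        intro x hx y hy hxy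
        refine Metric.ball_disjoint_ball ?_
        have := hdisc x hx y hy hxy
        linarith
      have : Function.Injective b' := b'.orthonormal.linearIndependent.injective
      rw [← Set.countable_univ_iff]
      rw [← Set.image_univ] at hr
      exact Set.countable_of_injective_of_countable_image this.injOn hr
    obtain ⟨f, hf⟩ := exists_injective_nat w'
    exact ⟨w', b', fun i => b (Infinite.natEmbedding w (f i)),
      b.orthonormal.comp _ ((Infinite.natEmbedding w).injective.comp hf)⟩

/-- A closed subspace `S` embeds isometrically into any closed subspace of at least the same
dimension; the embedding is extended by zero to the orthogonal complement of `S`. -/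
theorem exists_partialIsometry [CompleteSpace X] [CompleteSpace Y]
    [TopologicalSpace.SeparableSpace X] (S : Submodule ℂ X) (T : Submodule ℂ Y)
    (hS : IsClosed (S : Set X)) (hT : IsClosed (T : Set Y)) (h : edim S ≤ edim T) :
    ∃ G : X →L[ℂ] Y, (∀ x, G x ∈ T) ∧ (∀ x ∈ S, ‖G x‖ = ‖x‖) ∧ (∀ x ∈ Sᗮ, G x = 0) := by
  have : CompleteSpace S := hS.completeSpace_coe
  have : CompleteSpace T := hT.completeSpace_coe
  have : TopologicalSpace.SeparableSpace S :=
    (TopologicalSpace.IsSeparable.of_separableSpace (S : Set X)).separableSpace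
  have h' : edim (⊤ : Submodule ℂ S) ≤ edim (⊤ : Submodule ℂ T) := by
    simpa [edim, rank_top] using h
  obtain ⟨κ, b, v, hv⟩ := exists_hilbertBasis_orthonormal_of_edim_le h'
  let g : S →ₗᵢ[ℂ] T := hv.orthogonalFamily.linearIsometry.comp b.repr.toLinearIsometry
  refine ⟨T.subtypeL ∘L g.toContinuousLinearMap ∘L S.orthogonalProjectionOnto, ?_, ?_, ?_⟩
  · intro x
    simp
  · intro x hx
    have : S.orthogonalProjectionOnto x = ⟨x, hx⟩ :=
      Submodule.orthogonalProjectionOnto_mem_subspace_eq_self ⟨x, hx⟩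
    have h2 : ‖g ⟨x, hx⟩‖ = ‖x‖ := g.norm_map _
    change ‖((g (S.orthogonalProjectionOnto x) : T) : Y)‖ = ‖x‖
    rw [this]
    exact h2
  · intro x hx
    have : S.orthogonalProjectionOnto x = 0 :=
      Submodule.orthogonalProjectionOnto_eq_zero_iff.2 hx
    simp [this]

end EDim

/-- A family of operators with mutually orthogonal ranges and initial spaces, uniformly bounded,
can be summed. -/
theorem exists_hasSum_of_orthogonal {κ X Y : Type*} [NormedAddCommGroup X] [InnerProductSpace ℂ X]
    [NormedAddCommGroup Y] [InnerProductSpace ℂ Y] [CompleteSpace Y]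
    (T : κ → X →L[ℂ] Y) (F : κ → X → X) {c : ℝ} (hc : 0 ≤ c)
    (hT : ∀ i j, i ≠ j → ∀ x, ⟪T i x, T j x⟫_ℂ = 0)
    (hF : ∀ (s : Finset κ) (x : X), ∑ i ∈ s, ‖F i x‖ ^ 2 ≤ ‖x‖ ^ 2)
    (hTF : ∀ i x, ‖T i x‖ ≤ c * ‖F i x‖) :
    ∃ S : X →L[ℂ] Y, ‖S‖ ≤ c ∧ (∀ x, HasSum (fun i => T i x) (S x)) ∧
      ∀ x, HasSum (fun i => ‖T i x‖ ^ 2) (‖S x‖ ^ 2) := by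
  have hnorm : ∀ (x : X) (s : Finset κ), ‖∑ i ∈ s, T i x‖ ^ 2 = ∑ i ∈ s, ‖T i x‖ ^ 2 := by
    intro x s
    classical
    induction s using Finset.induction_on with
    | empty => simp
    | insert a s ha ih =>
      rw [Finset.sum_insert ha, Finset.sum_insert ha, ← ih, sq, sq, sq]
      refine norm_add_sq_eq_norm_sq_add_norm_sq_of_inner_eq_zero (𝕜 := ℂ) _ _ ?_
      rw [inner_sum]
      exact Finset.sum_eq_zero fun i hi => hT _ _ (ne_of_mem_of_not_mem hi ha).symm _
  have hle : ∀ (s : Finset κ) (x : X), ∑ i ∈ s, ‖T i x‖ ^ 2 ≤ (c * ‖x‖) ^ 2 := by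
    intro s x
    calc ∑ i ∈ s, ‖T i x‖ ^ 2 ≤ ∑ i ∈ s, c ^ 2 * ‖F i x‖ ^ 2 := by
          refine Finset.sum_le_sum fun i _ => ?_
          rw [← mul_pow]
          exact pow_le_pow_left₀ (norm_nonneg _) (hTF i x) 2
      _ = c ^ 2 * ∑ i ∈ s, ‖F i x‖ ^ 2 := by rw [Finset.mul_sum]
      _ ≤ c ^ 2 * ‖x‖ ^ 2 := by gcongr; exact hF s x
      _ = _ := by ring
  have hsq : ∀ x, Summable fun i => ‖T i x‖ ^ 2 := fun x =>
    summable_of_sum_le (fun _ => by positivity) (fun s => hle s x)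
  have hsum : ∀ x, Summable fun i => T i x := by
    intro x
    rw [summable_iff_vanishing_norm]
    intro ε hε
    have := (summable_iff_vanishing_norm.1 (hsq x)) (ε ^ 2) (by positivity)
    obtain ⟨s, hs⟩ := this
    refine ⟨s, fun t ht => ?_⟩
    have h1 := hs t ht
    rw [← hnorm, Real.norm_of_nonneg (by positivity)] at h1
    exact lt_of_pow_lt_pow_left₀ 2 hε.le h1
  have hbound : ∀ x, ‖∑' i, T i x‖ ≤ c * ‖x‖ := by
    intro x
    refine le_of_tendsto (hsum x).hasSum.norm (Filter.Eventually.of_forall fun s => ?_)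
    refine le_of_sq_le_sq ?_ (by positivity)
    rw [hnorm]
    exact hle s x
  let S : X →ₗ[ℂ] Y :=
    { toFun := fun x => ∑' i, T i x
      map_add' := fun x y => by
        simp only [map_add]
        exact (hsum x).tsum_add (hsum y)
      map_smul' := fun a x => by
        simp only [map_smul, RingHom.id_apply]
        exact (hsum x).tsum_const_smul a }
  refine ⟨S.mkContinuous c hbound, S.mkContinuous_norm_le hc _, fun x => (hsum x).hasSum,
    fun x => ?_⟩
  have h1 : Filter.Tendsto (fun s : Finset κ => ‖∑ i ∈ s, T i x‖ ^ 2) Filter.atTop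
      (nhds (‖∑' i, T i x‖ ^ 2)) := (hsum x).hasSum.norm.pow 2
  simp only [hnorm] at h1
  exact h1

/-- An increasing family of orthogonal projections indexed by a linear order. -/
structure ProjNest {ι X : Type*} [LinearOrder ι] [NormedAddCommGroup X] [InnerProductSpace ℂ X]
    (p : ι → X →L[ℂ] X) : Prop where
  inner_left : ∀ i x y, ⟪p i x, y⟫_ℂ = ⟪x, p i y⟫_ℂ
  apply_of_ge : ∀ {i j}, i ≤ j → ∀ x, p j (p i x) = p i x

/-- The difference `p j - p i` of two projections in a nest. -/
def gap {ι X : Type*} [NormedAddCommGroup X] [InnerProductSpace ℂ X]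
    (p : ι → X →L[ℂ] X) (i j : ι) : X →L[ℂ] X := p j - p i

/-- The subspace fixed by `gap p i j`. -/
def blk {ι X : Type*} [NormedAddCommGroup X] [InnerProductSpace ℂ X]
    (p : ι → X →L[ℂ] X) (i j : ι) : Submodule ℂ X :=
  LinearMap.ker (ContinuousLinearMap.id ℂ X - gap p i j : X →L[ℂ] X).toLinearMap

/-- Operators mapping the `i`-th subspace of one nest into the `i`-th subspace of another. -/
def Tri {ι X Y : Type*} [NormedAddCommGroup X] [InnerProductSpace ℂ X]
    [NormedAddCommGroup Y] [InnerProductSpace ℂ Y]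
    (p : ι → X →L[ℂ] X) (q : ι → Y →L[ℂ] Y) (T : X →L[ℂ] Y) : Prop :=
  ∀ i x, q i (T (p i x)) = T (p i x)

section ProjNest

variable {ι X Y Z : Type*} [NormedAddCommGroup X] [InnerProductSpace ℂ X]
  [NormedAddCommGroup Y] [InnerProductSpace ℂ Y] [NormedAddCommGroup Z] [InnerProductSpace ℂ Z]
  {p : ι → X →L[ℂ] X} {q : ι → Y →L[ℂ] Y} {r : ι → Z →L[ℂ] Z} {i j k l : ι}

theorem gap_apply (x : X) : gap p i j x = p j x - p i x := rfl

theorem gap_self (x : X) : gap p i i x = 0 := by simp [gap_apply]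

theorem gap_add_gap (x : X) : gap p i j x + gap p j k x = gap p i k x := by
  simp [gap_apply]

theorem mem_blk {x : X} : x ∈ blk p i j ↔ gap p i j x = x := by
  simp only [blk, LinearMap.mem_ker, ContinuousLinearMap.coe_coe, sub_apply,
    ContinuousLinearMap.id_apply, sub_eq_zero]
  exact eq_comm

theorem isClosed_blk : IsClosed (blk p i j : Set X) := ContinuousLinearMap.isClosed_ker _

theorem blk_self : blk p i i = ⊥ := by
  rw [eq_bot_iff]
  intro x hx
  rw [mem_blk, gap_self] at hx
  simp [hx]

namespace Tri

theorem comp {S : Y →L[ℂ] Z} {T : X →L[ℂ] Y} (hS : Tri q r S) (hT : Tri p q T) :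
    Tri p r (S ∘L T) := fun i x => by
  simp only [ContinuousLinearMap.comp_apply]
  rw [← hT i x, hS]

theorem add {S T : X →L[ℂ] Y} (hS : Tri p q S) (hT : Tri p q T) : Tri p q (S + T) :=
  fun i x => by simp only [add_apply, map_add, hS i x, hT i x]

theorem sub {S T : X →L[ℂ] Y} (hS : Tri p q S) (hT : Tri p q T) : Tri p q (S - T) :=
  fun i x => by simp only [sub_apply, map_sub, hS i x, hT i x]

theorem smul {T : X →L[ℂ] Y} (a : ℂ) (hT : Tri p q T) : Tri p q (a • T) :=
  fun i x => by simp only [smul_apply, map_smul, hT i x]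

theorem zero : Tri p q (0 : X →L[ℂ] Y) := fun i x => by simp

theorem of_hasSum {κ : Type*} {T : κ → X →L[ℂ] Y} {S : X →L[ℂ] Y} (hT : ∀ m, Tri p q (T m))
    (hS : ∀ x, HasSum (fun m => T m x) (S x)) : Tri p q S := fun i x => by
  refine HasSum.unique ?_ (hS (p i x))
  have := (hS (p i x)).mapL (q i)
  simpa only [hT _ i x] using this

theorem apply_eq {T : X →L[ℂ] Y} (hT : Tri p q T) {x : X} (hx : p i x = x) : q i (T x) = T x := by
  rw [← hx, hT]

end Tri

variable [LinearOrder ι]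

namespace ProjNest

variable (hp : ProjNest p)
include hp

theorem apply_of_le (h : i ≤ j) (x : X) : p i (p j x) = p i x := by
  refine ext_inner_right ℂ fun y => ?_
  rw [hp.inner_left, hp.inner_left, hp.apply_of_ge h, hp.inner_left]

theorem gap_inner_left (x y : X) : ⟪gap p i j x, y⟫_ℂ = ⟪x, gap p i j y⟫_ℂ := by
  simp only [gap_apply, inner_sub_left, inner_sub_right, hp.inner_left]

theorem apply_gap_of_ge (h : j ≤ k) (hij : i ≤ j) (x : X) : p k (gap p i j x) = gap p i j x := by
  rw [gap_apply, map_sub, hp.apply_of_ge h, hp.apply_of_ge (hij.trans h)]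

theorem apply_gap_of_le (h : k ≤ i) (hij : i ≤ j) (x : X) : p k (gap p i j x) = 0 := by
  rw [gap_apply, map_sub, hp.apply_of_le h, hp.apply_of_le (h.trans hij), sub_self]

theorem gap_apply_of_le (h : k ≤ i) (hij : i ≤ j) (x : X) : gap p i j (p k x) = 0 := by
  rw [gap_apply, hp.apply_of_ge h, hp.apply_of_ge (h.trans hij), sub_self]

theorem gap_apply_of_ge (h : j ≤ k) (hij : i ≤ j) (x : X) : gap p i j (p k x) = gap p i j x := by
  rw [gap_apply, hp.apply_of_le h, hp.apply_of_le (hij.trans h), gap_apply]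

theorem gap_gap_of_disjoint (hij : i ≤ j) (hkl : k ≤ l) (h : j ≤ k ∨ l ≤ i) (x : X) :
    gap p i j (gap p k l x) = 0 := by
  rw [gap_apply (i := k), map_sub]
  rcases h with h | h
  · rw [hp.gap_apply_of_ge h hij, hp.gap_apply_of_ge (h.trans hkl) hij, sub_self]
  · rw [hp.gap_apply_of_le h hij, hp.gap_apply_of_le (hkl.trans h) hij, sub_self]

theorem gap_gap_of_subset (hki : k ≤ i) (hij : i ≤ j) (hjl : j ≤ l) (x : X) :
    gap p i j (gap p k l x) = gap p i j x := by
  rw [gap_apply (i := k), map_sub, hp.gap_apply_of_ge hjl hij, hp.gap_apply_of_le hki hij, sub_zero]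

theorem gap_gap_of_subset' (hki : k ≤ i) (hij : i ≤ j) (hjl : j ≤ l) (x : X) :
    gap p k l (gap p i j x) = gap p i j x := by
  rw [gap_apply (i := k), hp.apply_gap_of_ge hjl hij, hp.apply_gap_of_le hki hij, sub_zero]

theorem gap_idem (hij : i ≤ j) (x : X) : gap p i j (gap p i j x) = gap p i j x :=
  hp.gap_gap_of_subset le_rfl hij le_rfl x

theorem gap_mem_blk (hij : i ≤ j) (x : X) : gap p i j x ∈ blk p i j :=
  mem_blk.2 (hp.gap_idem hij x)

theorem norm_gap_sq (hij : i ≤ j) (x : X) : ‖gap p i j x‖ ^ 2 + ‖x - gap p i j x‖ ^ 2 = ‖x‖ ^ 2 := by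
  have h : ⟪gap p i j x, x - gap p i j x⟫_ℂ = 0 := by
    rw [hp.gap_inner_left, map_sub, hp.gap_idem hij, sub_self, inner_zero_right]
  have := norm_add_sq_eq_norm_sq_add_norm_sq_of_inner_eq_zero _ _ h
  rw [add_sub_cancel] at this
  rw [sq, sq, sq, this]

theorem norm_gap_apply_le (hij : i ≤ j) (x : X) : ‖gap p i j x‖ ≤ ‖x‖ := by
  refine le_of_sq_le_sq ?_ (norm_nonneg x)
  nlinarith [hp.norm_gap_sq hij x, sq_nonneg ‖x - gap p i j x‖]

theorem sum_norm_gap_sq_le {κ : Type*} (a b : κ → ι) (hab : ∀ m, a m ≤ b m)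
    (hd : ∀ m m', m ≠ m' → b m ≤ a m' ∨ b m' ≤ a m) (s : Finset κ) (x : X) :
    ∑ m ∈ s, ‖gap p (a m) (b m) x‖ ^ 2 ≤ ‖x‖ ^ 2 := by
  classical
  suffices h : ∑ m ∈ s, ‖gap p (a m) (b m) x‖ ^ 2 + ‖x - ∑ m ∈ s, gap p (a m) (b m) x‖ ^ 2
      = ‖x‖ ^ 2 by
    nlinarith [sq_nonneg ‖x - ∑ m ∈ s, gap p (a m) (b m) x‖]
  induction s using Finset.induction_on with
  | empty => simp
  | insert m s hm ih =>
    rw [← ih, Finset.sum_insert hm, Finset.sum_insert hm,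
      ← hp.norm_gap_sq (hab m) (x - ∑ m ∈ s, gap p (a m) (b m) x)]
    have h0 : gap p (a m) (b m) (∑ m ∈ s, gap p (a m) (b m) x) = 0 := by
      rw [map_sum]
      refine Finset.sum_eq_zero fun m' hm' => ?_
      exact hp.gap_gap_of_disjoint (hab m) (hab m') (hd m m' (ne_of_mem_of_not_mem hm' hm).symm) x
    rw [map_sub, h0, sub_zero, sub_sub, add_comm (gap p (a m) (b m) x)]
    ring

theorem mem_blk_orthogonal (hij : i ≤ j) {x : X} : x ∈ (blk p i j)ᗮ ↔ gap p i j x = 0 := by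
  rw [Submodule.mem_orthogonal]
  constructor
  · intro h
    have h1 := h _ (hp.gap_mem_blk hij x)
    rw [← hp.gap_idem hij x, hp.gap_inner_left] at h1
    exact inner_self_eq_zero.1 h1
  · intro h y hy
    rw [← mem_blk.1 hy, hp.gap_inner_left, h, inner_zero_right]

theorem blk_mono (hki : k ≤ i) (hij : i ≤ j) (hjl : j ≤ l) : blk p i j ≤ blk p k l := by
  intro x hx
  rw [mem_blk] at hx ⊢
  rw [← hx, hp.gap_gap_of_subset' hki hij hjl]

theorem edim_blk_add (hij : i ≤ j) (hjk : j ≤ k) :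
    edim (blk p i j) + edim (blk p j k) = edim (blk p i k) := by
  rw [← edim_sup_of_disjoint]
  · congr 1
    refine le_antisymm (sup_le (hp.blk_mono le_rfl hij hjk) (hp.blk_mono hij hjk le_rfl)) ?_
    intro x hx
    rw [mem_blk, ← gap_add_gap (j := j)] at hx
    rw [← hx]
    exact Submodule.add_mem_sup (hp.gap_mem_blk hij x) (hp.gap_mem_blk hjk x)
  · rw [Submodule.disjoint_def]
    intro x hx hx'
    rw [mem_blk] at hx hx'
    rw [← hx, ← hx', hp.gap_gap_of_disjoint hij hjk (Or.inl le_rfl)]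

end ProjNest

namespace Tri

theorem id (hp : ProjNest p) : Tri p p (ContinuousLinearMap.id ℂ X) := fun i x => by
  simp [hp.apply_of_ge le_rfl]

theorem proj (hp : ProjNest p) (j : ι) : Tri p p (p j) := fun i x => by
  rcases le_total i j with h | h
  · rw [hp.apply_of_ge h, hp.apply_of_ge le_rfl]
  · rw [hp.apply_of_le h, hp.apply_of_ge h]

theorem of_gap (hp : ProjNest p) (i j : ι) : Tri p p (gap p i j) := (proj hp j).sub (proj hp i)

/-- An operator which kills level `i` and has range in a level `j ≤ i` is triangular. -/
theorem of_le (hp : ProjNest p) (hq : ProjNest q) {T : X →L[ℂ] Y} (hji : j ≤ i)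
    (h0 : ∀ x, T (p i x) = 0) (h1 : ∀ x, q j (T x) = T x) : Tri p q T := fun k x => by
  rcases le_total k i with h | h
  · rw [← hp.apply_of_ge h x, h0, map_zero]
  · rw [← h1, hq.apply_of_ge (hji.trans h)]

/-- An operator supported on an atom of the nest is triangular. -/
theorem of_covBy (hp : ProjNest p) (hq : ProjNest q) {T : X →L[ℂ] Y} (hij : i ⋖ j)
    (h0 : ∀ x, T (p i x) = 0) (h1 : ∀ x, q j (T x) = T x) : Tri p q T := fun k x => by
  rcases le_or_gt k i with h | h
  · rw [← hp.apply_of_ge h x, h0, map_zero]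
  · rw [← h1, hq.apply_of_ge (hij.ge_of_gt h)]

/-- `gap` annihilates the image of lower levels. -/
theorem gap_apply_eq_zero (hq : ProjNest q) {T : X →L[ℂ] Y} (hT : Tri p q T) (hij : i ≤ j)
    (hki : k ≤ i) (x : X) : gap q i j (T (p k x)) = 0 := by
  rw [← hT, hq.gap_apply_of_le hki hij]

theorem gap_apply_gap_eq_zero (hp : ProjNest p) (hq : ProjNest q) {T : X →L[ℂ] Y} (hT : Tri p q T)
    (hij : i ≤ j) (hki : l ≤ i) (hkl : k ≤ l) (x : X) :
    gap q i j (T (gap p k l x)) = 0 := by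
  rw [← hp.apply_gap_of_ge hki hkl, hT.gap_apply_eq_zero hq hij le_rfl]

/-- Compressions to intervals of the nest are multiplicative on triangular operators. -/
theorem gap_comp (hp : ProjNest p) (hr : ProjNest r) {S : Y →L[ℂ] Z}
    {T : X →L[ℂ] Y} (hS : Tri q r S) (hT : Tri p q T) (hij : i ≤ j) (x : X) :
    gap r i j (S (gap q i j (T (gap p i j x)))) =
      gap r i j (S (T (gap p i j x))) := by
  rw [gap_apply (p := q), hT.apply_eq (hp.apply_gap_of_ge le_rfl hij x), map_sub, map_sub,
    hS.gap_apply_eq_zero hr hij le_rfl, sub_zero]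

end Tri

end ProjNest

section Obstruction

variable {ι X Y : Type*} [LinearOrder ι] [NormedAddCommGroup X] [InnerProductSpace ℂ X]
  [NormedAddCommGroup Y] [InnerProductSpace ℂ Y]
  {p : ι → X →L[ℂ] X} {q : ι → Y →L[ℂ] Y} {i j k l : ι} {n a b L : ℕ}

theorem ProjNest.edim_blk_mono (hp : ProjNest p) (hki : k ≤ i) (hij : i ≤ j) (hjl : j ≤ l) :
    edim (blk p i j) ≤ edim (blk p k l) :=
  edim_mono (hp.blk_mono hki hij hjl)

/-- A block of a nest embeds isometrically in any closed subspace which is large enough. -/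
theorem ProjNest.exists_isometry [CompleteSpace X] [CompleteSpace Y]
    [TopologicalSpace.SeparableSpace Y] (hq : ProjNest q) (hij : i ≤ j) (T : Submodule ℂ X)
    (hT : IsClosed (T : Set X)) (h : edim (blk q i j) ≤ edim T) :
    ∃ S : Y →L[ℂ] X, (∀ x, S x ∈ T) ∧ ∀ x, ‖S x‖ = ‖gap q i j x‖ := by
  obtain ⟨S, h1, h2, h3⟩ := exists_partialIsometry (blk q i j) T isClosed_blk hT h
  refine ⟨S, h1, fun x => ?_⟩
  rw [← h2 _ (hq.gap_mem_blk hij x)]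
  have : S (x - gap q i j x) = 0 := h3 _ ((hq.mem_blk_orthogonal hij).2 (by
    rw [map_sub, hq.gap_idem hij, sub_self]))
  rw [map_sub, sub_eq_zero] at this
  rw [this]

/-- Chains `M = K₀ < K₁ < ⋯ < K_{L+1} = N` in which each interval, except the last, is at least
`n` times as large as the whole interval above it. -/
def StrongChain (p : ι → X →L[ℂ] X) (n : ℕ) : ℕ → ι → ι → Prop
  | 0, M, N => M < N
  | L + 1, M, N => ∃ K, M < K ∧ n * edim (blk p K N) ≤ edim (blk p M K) ∧ StrongChain p n L K N

namespace StrongChain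

theorem lt : ∀ {L : ℕ} {M N : ι}, StrongChain p n L M N → M < N
  | 0, _, _, h => h
  | _ + 1, _, _, ⟨_, h, _, h'⟩ => h.trans h'.lt

theorem extend_left (hp : ProjNest p) {M M' N : ι} (hM : M' ≤ M) (h : StrongChain p n L M N) :
    StrongChain p n L M' N := by
  cases L with
  | zero => exact lt_of_le_of_lt hM h
  | succ L =>
    obtain ⟨K, h1, h2, h3⟩ := h
    exact ⟨K, hM.trans_lt h1, h2.trans (hp.edim_blk_mono hM h1.le le_rfl), h3⟩

theorem of_add (hp : ProjNest p) {M N : ι} (h : StrongChain p n (L + a) M N) :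
    StrongChain p n L M N := by
  induction a with
  | zero => exact h
  | succ a ih =>
    obtain ⟨K, h1, -, h3⟩ := h
    exact ih (h3.extend_left hp h1.le)

theorem bisect (hp : ProjNest p) {M N x : ι} (hxN : x ≤ N)
    (h : StrongChain p n (a + b + 1) M N) : StrongChain p n a M x ∨ StrongChain p n b x N := by
  induction a generalizing M with
  | zero =>
    rw [zero_add] at h
    obtain ⟨K, h1, h2, h3⟩ := h
    rcases le_or_gt x K with hx | hx
    · exact Or.inr (h3.extend_left hp hx)
    · exact Or.inl (h1.trans hx)
  | succ a ih =>
    obtain ⟨K, h1, h2, h3⟩ := h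
    rcases le_or_gt x K with hx | hx
    · right
      rw [show a + 1 + b = b + (a + 1) by ring] at h3
      exact (h3.extend_left hp hx).of_add hp
    · rw [show a + 1 + b = a + b + 1 by ring] at h3
      refine (ih h3).imp (fun h => ⟨K, h1, le_trans ?_ h2, h⟩) id
      gcongr
      exact hp.edim_blk_mono le_rfl hx.le hxN

theorem split (hp : ProjNest p) {M N : ι} (h : StrongChain p n (a + b + 1) M N) :
    ∃ x, StrongChain p n a M x ∧ StrongChain p n b x N := by
  induction a generalizing M with
  | zero =>
    rw [zero_add] at h
    obtain ⟨K, h1, h2, h3⟩ := h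
    exact ⟨K, h1, h3⟩
  | succ a ih =>
    obtain ⟨K, h1, h2, h3⟩ := h
    rw [show a + 1 + b = a + b + 1 by ring] at h3
    obtain ⟨x, hx1, hx2⟩ := ih h3
    refine ⟨x, ⟨K, h1, le_trans ?_ h2, hx1⟩, hx2⟩
    gcongr
    exact hp.edim_blk_mono le_rfl hx1.lt.le hx2.lt.le

/-- If there are arbitrarily long strong chains in an interval, then it contains strong chains of
every length living on mutually disjoint intervals. -/
theorem exists_disjoint (hp : ProjNest p) {M N : ι}
    (h : ∀ L, ∃ N' ≤ N, StrongChain p n L M N') :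
    ∃ a b : ℕ → ι, (∀ L, StrongChain p n L (a L) (b L)) ∧
      ∀ L L', L ≠ L' → b L ≤ a L' ∨ b L' ≤ a L := by
  let St := {x : ι × ι // ∀ L, ∃ N' ≤ x.2, StrongChain p n L x.1 N'}
  have step : ∀ (L : ℕ) (s : St), ∃ (t : St) (J : ι × ι), StrongChain p n L J.1 J.2 ∧
      s.1.1 ≤ t.1.1 ∧ t.1.2 ≤ s.1.2 ∧ s.1.1 ≤ J.1 ∧ J.2 ≤ s.1.2 ∧
      (t.1.2 ≤ J.1 ∨ J.2 ≤ t.1.1) := by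
    rintro L ⟨⟨M, N⟩, hs⟩
    obtain ⟨K, hK, hc⟩ := hs (L + L + 1)
    obtain ⟨x, hx1, hx2⟩ := hc.split hp
    have hxN := hx2.lt.le.trans hK
    by_cases hP : ∀ L, ∃ N' ≤ x, StrongChain p n L M N'
    · exact ⟨⟨(M, x), hP⟩, (x, K), hx2, le_rfl, hxN, hx1.lt.le, hK, Or.inl le_rfl⟩
    · push Not at hP
      obtain ⟨L', hL'⟩ := hP
      refine ⟨⟨(x, N), fun L'' => ?_⟩, (M, x), hx1, hx1.lt.le, le_rfl, le_rfl, hxN,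
        Or.inr le_rfl⟩
      obtain ⟨K', hK', hc'⟩ := hs (L' + L'' + 1)
      rcases le_total x K' with h' | h'
      · exact ⟨K', hK', (hc'.bisect hp h').resolve_left (hL' x le_rfl)⟩
      · rw [add_assoc] at hc'
        exact absurd (hc'.of_add hp) (hL' K' h')
  choose t J h1 h2 h3 h4 h5 h6 using step
  let s : ℕ → St := fun m => Nat.rec ⟨(M, N), h⟩ (fun L x => t L x) m
  have hs1 : Monotone fun m => (s m).1.1 := monotone_nat_of_le_succ fun m => h2 m (s m)
  have hs2 : Antitone fun m => (s m).1.2 := antitone_nat_of_succ_le fun m => h3 m (s m)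
  have key : ∀ L L', L < L' → (J L (s L)).2 ≤ (J L' (s L')).1 ∨
      (J L' (s L')).2 ≤ (J L (s L)).1 := by
    intro L L' hL
    rcases h6 L (s L) with h' | h'
    · exact Or.inr ((h5 L' _).trans ((hs2 (Nat.succ_le_of_lt hL)).trans h'))
    · exact Or.inl (h'.trans ((hs1 (Nat.succ_le_of_lt hL)).trans (h4 L' _)))
  refine ⟨fun m => (J m (s m)).1, fun m => (J m (s m)).2, fun L => h1 _ _, fun L L' hL => ?_⟩
  rcases lt_or_gt_of_ne hL with h' | h'
  · exact key _ _ h'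
  · exact (key _ _ h').symm

/-- The operator attached to a strong chain: solutions of small perturbations of `A w = v` are
large. -/
theorem exists_obstruction [CompleteSpace X] [CompleteSpace Y] [TopologicalSpace.SeparableSpace Y]
    (hp : ProjNest p) (hq : ProjNest q)
    (hpq : ∀ i j, i ≤ j → edim (blk q i j) ≤ n * edim (blk p i j))
    (hne : ∀ i j, i < j → blk p i j ≠ ⊥) :
    ∀ (L : ℕ) (M N : ι), StrongChain p n L M N → ∃ (K : ι) (A : Y →L[ℂ] X), M ≤ K ∧ K ≤ N ∧
      Tri q p A ∧ (∀ x, gap p M N (A x) = A x) ∧ (∀ x, ‖A x‖ = ‖gap q K N x‖) ∧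
      ∃ v, gap p M N v = v ∧ ‖v‖ = 1 ∧ ∀ B : Y →L[ℂ] X, Tri q p B → ‖B‖ ≤ 1 / 4 →
        ∀ w, gap q M N w = w → gap p M N (A w + B w) = v → 2 ^ (L + 1) ≤ ‖w‖
  | 0, M, N, h => by
    obtain ⟨v, hv, hv0⟩ := Submodule.exists_mem_ne_zero_of_ne_bot (hne M N h)
    refine ⟨N, 0, le_of_lt h, le_rfl, Tri.zero, by simp, by simp [gap_self],
      ((‖v‖⁻¹ : ℝ) : ℂ) • v, ?_, ?_, ?_⟩
    · rw [map_smul, mem_blk.1 hv]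
    · rw [norm_smul]
      have : ‖v‖ ≠ 0 := by simpa using hv0
      simp [this]
    · intro B _ hB w hw h1
      have h2 : ‖((‖v‖⁻¹ : ℝ) : ℂ) • v‖ = 1 := by
        rw [norm_smul]
        have : ‖v‖ ≠ 0 := by simpa using hv0
        simp [this]
      rw [← h1, zero_apply, zero_add] at h2
      have h3 := hp.norm_gap_apply_le (le_of_lt h) (B w)
      have h4 := B.le_of_opNorm_le hB w
      norm_num
      linarith
  | L + 1, M, N, ⟨K, hMK, hdim, hc⟩ => by
    obtain ⟨K', A, hK1, hK2, hA, hAr, hAn, v, hv, hv1, hw⟩ :=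
      exists_obstruction hp hq hpq hne L K N hc
    have hKN := hc.lt.le
    have hd : edim (blk q K K') ≤ edim (blk p M K) := by
      refine le_trans (hq.edim_blk_mono le_rfl hK1 hK2) ((hpq K N hKN).trans hdim)
    obtain ⟨S, hS1, hS2⟩ := hq.exists_isometry hK1 (blk p M K) isClosed_blk hd
    have hS1' : ∀ x, gap p M K (S x) = S x := fun x => mem_blk.1 (hS1 x)
    have hST : Tri q p S := by
      refine Tri.of_le hq hp (le_refl K) (fun x => ?_) fun x => ?_
      · rw [← norm_eq_zero, hS2, hq.gap_apply_of_le le_rfl hK1, norm_zero]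
      · rw [← hS1', hp.apply_gap_of_ge le_rfl hMK.le]
    have hnorm : ∀ x, ‖S x + A x‖ = ‖gap q K N x‖ := by
      intro x
      have e1 : ⟪S x, A x⟫_ℂ = 0 := by
        rw [← hS1', hp.gap_inner_left, ← hAr,
          hp.gap_gap_of_disjoint hMK.le hKN (Or.inl le_rfl), inner_zero_right]
      have e2 : ⟪gap q K K' x, gap q K' N x⟫_ℂ = 0 := by
        rw [hq.gap_inner_left, hq.gap_gap_of_disjoint hK1 hK2 (Or.inl le_rfl), inner_zero_right]
      have := norm_add_sq_eq_norm_sq_add_norm_sq_of_inner_eq_zero _ _ e1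
      have h' := norm_add_sq_eq_norm_sq_add_norm_sq_of_inner_eq_zero _ _ e2
      rw [gap_add_gap, ← hS2, ← hAn, ← this] at h'
      exact (mul_self_inj (norm_nonneg _) (norm_nonneg _)).1 h'.symm
    refine ⟨K, S + A, hMK.le, hKN, hST.add hA, fun x => ?_, hnorm, v, ?_, hv1, ?_⟩
    · rw [add_apply, map_add]
      congr 1
      · rw [← hS1', hp.gap_gap_of_subset' le_rfl hMK.le hKN]
      · rw [← hAr, hp.gap_gap_of_subset' hMK.le hKN le_rfl]
    · rw [← hv, hp.gap_gap_of_subset' hMK.le hKN le_rfl]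
    · intro B hBT hB w hwM h1
      have hMN := hMK.le.trans hKN
      have hAw : A w = A (gap q K N w) := by
        rw [← sub_eq_zero, ← map_sub, ← norm_eq_zero, hAn, map_sub,
          hq.gap_gap_of_subset hK1 hK2 le_rfl, sub_self, norm_zero]
      have hBw : gap p K N (B w) = gap p K N (B (gap q K N w)) := by
        nth_rewrite 1 [← hwM]
        rw [← gap_add_gap (p := q) (j := K), map_add, map_add,
          hBT.gap_apply_gap_eq_zero hq hp hKN le_rfl hMK.le, zero_add]
      have h2 : gap p K N (A (gap q K N w) + B (gap q K N w)) = v := by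
        have := congrArg (gap p K N) h1
        rw [hp.gap_gap_of_subset hMK.le hKN le_rfl, hv, add_apply, map_add, map_add,
          ← hS1', hp.gap_gap_of_disjoint hKN hMK.le (Or.inr le_rfl), zero_add, hBw, hAw] at this
        rw [map_add, this]
      have h3 := hw B hBT hB _ (hq.gap_idem hKN w) h2
      have h4 : S w + A w = v - gap p M N (B w) := by
        rw [← h1, map_add, add_sub_cancel_right, add_apply, map_add]
        congr 1
        · rw [← hS1', hp.gap_gap_of_subset' le_rfl hMK.le hKN]
        · rw [← hAr, hp.gap_gap_of_subset' hMK.le hKN le_rfl]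
      have h5 : ‖gap q K N w‖ ≤ 1 + 1 / 4 * ‖w‖ := by
        rw [← hnorm, h4]
        refine (norm_sub_le _ _).trans ?_
        rw [hv1]
        gcongr
        exact (hp.norm_gap_apply_le hMN _).trans (B.le_of_opNorm_le hB w)
      have h6 : (1 : ℝ) ≤ 2 ^ L := one_le_pow₀ (by norm_num)
      rw [pow_succ] at h3 ⊢
      rw [pow_succ]
      linarith

end StrongChain

/-- Every triangular operator from `Y` to `X` has arbitrarily small triangular perturbations with
a triangular right inverse. -/
def RightDense (p : ι → X →L[ℂ] X) (q : ι → Y →L[ℂ] Y) : Prop :=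
  ∀ A : Y →L[ℂ] X, Tri q p A → ∀ ε : ℝ, 0 < ε → ∃ (B : Y →L[ℂ] X) (C : X →L[ℂ] Y),
    Tri q p B ∧ Tri p q C ∧ ‖B‖ ≤ ε ∧ ∀ x, A (C x) + B (C x) = x

theorem RightDense.exists_not_strongChain [CompleteSpace X] [CompleteSpace Y]
    [TopologicalSpace.SeparableSpace Y] (hd : RightDense p q) (hp : ProjNest p) (hq : ProjNest q)
    (hpq : ∀ i j, i ≤ j → edim (blk q i j) ≤ n * edim (blk p i j))
    (hne : ∀ i j, i < j → blk p i j ≠ ⊥) (M N : ι) :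
    ∃ L, ∀ N' ≤ N, ¬ StrongChain p n L M N' := by
  by_contra! hall
  obtain ⟨a, b, hab, hdis⟩ := StrongChain.exists_disjoint hp hall
  have hle : ∀ L, a L ≤ b L := fun L => (hab L).lt.le
  choose K A hK1 hK2 hA hAr hAn v hv hv1 hw using
    fun L => StrongChain.exists_obstruction hp hq hpq hne L _ _ (hab L)
  obtain ⟨S, -, hS, -⟩ := exists_hasSum_of_orthogonal A (fun L => gap q (a L) (b L)) zero_le_one
    (fun L L' hL x => by
      rw [← hAr, hp.gap_inner_left, ← hAr L', hp.gap_gap_of_disjoint (hle L) (hle L')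
        (hdis L L' hL), inner_zero_right])
    (hq.sum_norm_gap_sq_le a b hle hdis)
    (fun L x => by
      rw [one_mul, hAn, ← hq.gap_gap_of_subset (hK1 L) (hK2 L) le_rfl]
      exact hq.norm_gap_apply_le (hK2 L) _)
  obtain ⟨B, C, hB, hC, hBn, hABC⟩ := hd S (Tri.of_hasSum hA hS) (1 / 4) (by norm_num)
  obtain ⟨L, hL⟩ := pow_unbounded_of_one_lt ‖C‖ (one_lt_two (α := ℝ))
  set F := gap q (a L) (b L)
  have hSL : ∀ x, S (F x) = A L (F x) := fun x => by
    refine (hS (F x)).unique (hasSum_single L fun L' hL' => ?_)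
    rw [← norm_eq_zero, hAn, hq.gap_gap_of_disjoint (hK2 L') (hle L), norm_zero]
    refine (hdis L L' hL'.symm).symm.imp id fun h => h.trans (hK1 L')
  have hSB : Tri q p (S + B) := (Tri.of_hasSum hA hS).add hB
  have h1 : gap p (a L) (b L) (A L (F (C (v L))) + B (F (C (v L)))) = v L := by
    rw [← hSL, ← add_apply]
    have := hSB.gap_comp hp hp hC (hle L) (v L)
    rw [hv L] at this
    rw [this, add_apply, hABC, hv L]
  have h2 := hw L B hB hBn _ (hq.gap_idem (hle L) _) h1
  have h3 : ‖F (C (v L))‖ ≤ ‖C‖ := by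
    refine (hq.norm_gap_apply_le (hle L) _).trans ((C.le_opNorm _).trans ?_)
    rw [hv1, mul_one]
  rw [pow_succ] at h2
  have : (0 : ℝ) < 2 ^ L := by positivity
  linarith

end Obstruction

section Necessary

variable {ι X Y : Type*} [LinearOrder ι] [NormedAddCommGroup X] [InnerProductSpace ℂ X]
  [NormedAddCommGroup Y] [InnerProductSpace ℂ Y]
  {p : ι → X →L[ℂ] X} {q : ι → Y →L[ℂ] Y} {i j : ι} {n : ℕ}

theorem ProjNest.le_edim_of_strictAnti (hp : ProjNest p) (hne : ∀ i j, i < j → blk p i j ≠ ⊥)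
    {N : ℕ → ι} (hN : StrictAnti N) (a m : ℕ) : (m : ℕ∞) ≤ edim (blk p (N (a + m)) (N a)) := by
  induction m with
  | zero => simp
  | succ m ih =>
    have h1 : N (a + (m + 1)) < N (a + m) := hN (by omega)
    have h2 : N (a + m) ≤ N a := hN.antitone (by omega)
    rw [← hp.edim_blk_add h1.le h2, Nat.cast_add, Nat.cast_one, add_comm]
    exact add_le_add (Order.one_le_iff_ne_zero.2 fun h => hne _ _ h1 (edim_eq_zero_iff.1 h)) ih

theorem ProjNest.exists_strongChain (hp : ProjNest p) (hne : ∀ i j, i < j → blk p i j ≠ ⊥)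
    {N : ℕ → ι} (hN : StrictAnti N) : ∃ a, ∀ L, ∃ m, StrongChain p n L (N m) (N a) := by
  have key : ∃ a, ∀ i, a < i → ∃ m, i < m ∧
      n * edim (blk p (N i) (N a)) ≤ edim (blk p (N m) (N i)) := by
    by_cases h : ∀ a, ∃ m, a < m ∧ edim (blk p (N m) (N a)) = ⊤
    · refine ⟨0, fun i _ => ?_⟩
      obtain ⟨m, hm, hm'⟩ := h i
      exact ⟨m, hm, hm' ▸ le_top⟩
    · push Not at h
      obtain ⟨a, ha⟩ := h
      refine ⟨a, fun i hi => ?_⟩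
      obtain ⟨d, hd⟩ := ENat.ne_top_iff_exists.1 (ha i hi)
      refine ⟨i + (n * d + 1), by omega, ?_⟩
      rw [← hd]
      refine le_trans ?_ (hp.le_edim_of_strictAnti hne hN i (n * d + 1))
      exact_mod_cast Nat.le_succ _
  obtain ⟨a, ha⟩ := key
  refine ⟨a, fun L => ?_⟩
  suffices h : ∃ m, a < m ∧ StrongChain p n L (N m) (N a) from h.imp fun _ h => h.2
  induction L with
  | zero => exact ⟨a + 1, by omega, hN (by omega)⟩
  | succ L ih =>
    obtain ⟨i, hi, hc⟩ := ih
    obtain ⟨m, hm, hm'⟩ := ha i hi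
    exact ⟨m, hi.trans hm, N i, hN hm, hm', hc⟩

theorem RightDense.wellFoundedLT [OrderBot ι] [CompleteSpace X] [CompleteSpace Y]
    [TopologicalSpace.SeparableSpace Y] (hd : RightDense p q) (hp : ProjNest p) (hq : ProjNest q)
    (hpq : ∀ i j, i ≤ j → edim (blk q i j) ≤ n * edim (blk p i j))
    (hne : ∀ i j, i < j → blk p i j ≠ ⊥) : WellFoundedLT ι := by
  refine ⟨wellFounded_iff_isEmpty_descending_chain.2 ⟨fun ⟨N, hN⟩ => ?_⟩⟩
  obtain ⟨a, ha⟩ := hp.exists_strongChain (n := n) hne (strictAnti_nat_of_succ_lt hN)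
  obtain ⟨L, hL⟩ := hd.exists_not_strongChain hp hq hpq hne ⊥ (N a)
  obtain ⟨m, hm⟩ := ha L
  exact hL _ le_rfl (hm.extend_left hp bot_le)

theorem RightDense.finiteDimensional_of_covBy [CompleteSpace X] [CompleteSpace Y]
    [TopologicalSpace.SeparableSpace Y] (hd : RightDense p q) (hp : ProjNest p) (hq : ProjNest q)
    (hij : i ⋖ j) : FiniteDimensional ℂ (blk p i j) := by
  by_contra hinf
  have hle := hij.le
  have hne : blk p i j ≠ ⊥ := fun h => hinf (h ▸ inferInstance)
  obtain ⟨v, hv, hv1⟩ : ∃ v ∈ blk p i j, ‖v‖ = 1 := by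
    obtain ⟨v, hv, hv0⟩ := Submodule.exists_mem_ne_zero_of_ne_bot hne
    have h0 : ‖v‖ ≠ 0 := by simpa using hv0
    exact ⟨((‖v‖⁻¹ : ℝ) : ℂ) • v, Submodule.smul_mem _ _ hv, by rw [norm_smul]; simp [h0]⟩
  have hdim : edim (blk q i j) ≤ edim (blk p i j ⊓ (ℂ ∙ v)ᗮ) := by
    suffices h : edim (blk p i j ⊓ (ℂ ∙ v)ᗮ) = ⊤ from h ▸ le_top
    by_contra h
    have hfin := edim_lt_top_iff.1 (lt_top_iff_ne_top.2 h)
    refine hinf (Submodule.finiteDimensional_of_le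
      (S₂ := (blk p i j ⊓ (ℂ ∙ v)ᗮ) ⊔ (ℂ ∙ v)) fun x hx => ?_)
    rw [← sub_add_cancel x (⟪v, x⟫_ℂ • v)]
    refine Submodule.add_mem_sup ⟨Submodule.sub_mem _ hx (Submodule.smul_mem _ _ hv), ?_⟩
      (Submodule.smul_mem _ _ (Submodule.mem_span_singleton_self v))
    rw [SetLike.mem_coe, Submodule.mem_orthogonal_singleton_iff_inner_right, inner_sub_right,
      inner_smul_right, inner_self_eq_norm_sq_to_K, hv1]
    simp
  obtain ⟨A, hA1, hA2⟩ := hq.exists_isometry hle _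
    (isClosed_blk.inter (Submodule.isClosed_orthogonal _)) hdim
  have hA3 : ∀ x, gap p i j (A x) = A x := fun x => mem_blk.1 (hA1 x).1
  have hAT : Tri q p A := by
    refine Tri.of_covBy hq hp hij (fun x => ?_) fun x => ?_
    · rw [← norm_eq_zero, hA2, hq.gap_apply_of_le le_rfl hle, norm_zero]
    · rw [← hA3, hp.apply_gap_of_ge le_rfl hle]
  obtain ⟨B, C, hB, hC, hBn, hABC⟩ := hd A hAT (1 / 4) (by norm_num)
  set w := gap q i j (C v)
  have h1 : A w + gap p i j (B w) = v := by
    have := (hAT.add hB).gap_comp hp hp hC hle v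
    rw [mem_blk.1 hv, add_apply, add_apply, hABC, mem_blk.1 hv, map_add, hA3] at this
    exact this
  have h2 : ‖gap p i j (B w)‖ ≤ 1 / 4 * ‖w‖ :=
    (hp.norm_gap_apply_le hle _).trans (B.le_of_opNorm_le hBn w)
  have h3 : ‖w‖ ≤ 1 + 1 / 4 * ‖w‖ := by
    have : ‖A w‖ = ‖w‖ := by rw [hA2, hq.gap_idem hle]
    have h4 := norm_sub_le v (gap p i j (B w))
    rw [← eq_sub_of_add_eq h1, this, hv1] at h4
    linarith
  have h4 : (1 : ℝ) ≤ 1 / 4 * ‖w‖ := by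
    have e1 : ⟪v, A w⟫_ℂ = 0 :=
      Submodule.mem_orthogonal_singleton_iff_inner_right.1 (hA1 w).2
    have e2 : ⟪v, gap p i j (B w)⟫_ℂ = 1 := by
      have : ⟪v, A w + gap p i j (B w)⟫_ℂ = ⟪v, v⟫_ℂ := by rw [h1]
      rw [inner_add_right, e1, zero_add, inner_self_eq_norm_sq_to_K, hv1] at this
      simpa using this
    have e3 := norm_inner_le_norm (𝕜 := ℂ) v (gap p i j (B w))
    rw [e2, hv1, norm_one, one_mul] at e3
    exact e3.trans h2
  linarith

end Necessary

section EDim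

variable {X Y : Type*} [NormedAddCommGroup X] [InnerProductSpace ℂ X]
  [NormedAddCommGroup Y] [InnerProductSpace ℂ Y]

theorem edim_map_add_edim_inf_ker (T : X →L[ℂ] Y) (S : Submodule ℂ X) :
    edim (S.map T.toLinearMap) + edim (S ⊓ LinearMap.ker T.toLinearMap) = edim S := by
  have h := congrArg Cardinal.toENat
    (LinearMap.lift_rank_range_add_rank_ker (T.toLinearMap.domRestrict S))
  rw [LinearMap.range_domRestrict, LinearMap.ker_domRestrict, map_add, Cardinal.toENat_lift,
    Cardinal.toENat_lift, Cardinal.toENat_lift] at h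
  have h2 : Module.rank ℂ ((LinearMap.ker T.toLinearMap).comap S.subtype) =
      Module.rank ℂ (S ⊓ LinearMap.ker T.toLinearMap : Submodule ℂ X) := by
    rw [← Submodule.map_comap_subtype]
    exact (Submodule.equivMapOfInjective _ S.injective_subtype _).rank_eq
  rwa [h2] at h

theorem le_edim_inf_ker {T : X →L[ℂ] Y} {S : Submodule ℂ X} {W : Submodule ℂ Y} {a b : ℕ∞}
    (hT : ∀ x ∈ S, T x ∈ W) (hW : edim W ≤ a) (ha : a ≠ ⊤) (hab : a + b ≤ edim S) :
    b ≤ edim (S ⊓ LinearMap.ker T.toLinearMap) := by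
  rw [← edim_map_add_edim_inf_ker T] at hab
  have h1 : edim (S.map T.toLinearMap) ≤ a := by
    refine (edim_mono ?_).trans hW
    rintro _ ⟨x, hx, rfl⟩
    exact hT x hx
  exact (WithTop.add_le_add_iff_left ha).1 (hab.trans (add_le_add_left h1 _))

theorem edim_ker_orthogonal_le (T : X →L[ℂ] Y) {W : Submodule ℂ Y} (hT : ∀ x, T x ∈ W) :
    edim (LinearMap.ker T.toLinearMap)ᗮ ≤ edim W := by
  have h := edim_map_add_edim_inf_ker T (LinearMap.ker T.toLinearMap)ᗮ
  rw [inf_comm, Submodule.inf_orthogonal_eq_bot, edim_eq_zero_iff.2 rfl, add_zero] at h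
  rw [← h]
  refine edim_mono ?_
  rintro _ ⟨x, -, rfl⟩
  exact hT x

/-- A partial isometry with initial space `S` and final space inside `T`, with its adjoint. -/
theorem exists_partialIsometry_pair [CompleteSpace X] [CompleteSpace Y]
    [TopologicalSpace.SeparableSpace X] (S : Submodule ℂ X) (T : Submodule ℂ Y)
    (hS : IsClosed (S : Set X)) (hT : IsClosed (T : Set Y)) (h : edim S ≤ edim T) :
    ∃ (G : X →L[ℂ] Y) (V : Y →L[ℂ] X), ‖G‖ ≤ 1 ∧ ‖V‖ ≤ 1 ∧ (∀ x, G x ∈ T) ∧ (∀ y, V y ∈ S) ∧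
      (∀ x ∈ Sᗮ, G x = 0) ∧ (∀ y ∈ Tᗮ, V y = 0) ∧ ∀ x, x - V (G x) ∈ Sᗮ := by
  obtain ⟨G, h1, h2, h3⟩ := exists_partialIsometry S T hS hT h
  have : CompleteSpace S := hS.completeSpace_coe
  have hGP : ∀ x, ‖G x‖ = ‖S.starProjection x‖ := fun x => by
    rw [← h2 _ (S.starProjection_apply_mem x)]
    have := h3 _ (S.sub_starProjection_mem_orthogonal x)
    rw [map_sub, sub_eq_zero] at this
    rw [this]
  have hG1 : ‖G‖ ≤ 1 := G.opNorm_le_bound zero_le_one fun x => by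
    rw [hGP, one_mul]
    exact S.norm_starProjection_apply_le x
  have hVG : G.adjoint ∘L G = S.starProjection := by
    refine ContinuousLinearMap.coe_injective ((ext_inner_map _ _).1 fun x => ?_)
    simp only [ContinuousLinearMap.coe_coe, ContinuousLinearMap.comp_apply]
    have hPP : S.starProjection (S.starProjection x) = S.starProjection x :=
      S.starProjection_eq_self_iff.2 (S.starProjection_apply_mem x)
    rw [ContinuousLinearMap.adjoint_inner_left, ← hPP, S.inner_starProjection_left_eq_right,
      inner_self_eq_norm_sq_to_K, inner_self_eq_norm_sq_to_K, hGP]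
  refine ⟨G, G.adjoint, hG1, by simpa using hG1, h1, fun y => ?_, h3, fun y hy => ?_, fun x => ?_⟩
  · rw [← S.orthogonal_orthogonal, Submodule.mem_orthogonal]
    intro z hz
    rw [ContinuousLinearMap.adjoint_inner_right, h3 z hz, inner_zero_left]
  · refine ext_inner_left ℂ fun x => ?_
    rw [ContinuousLinearMap.adjoint_inner_right, inner_zero_right]
    exact hy _ (h1 x)
  · rw [← ContinuousLinearMap.comp_apply, hVG]
    exact S.sub_starProjection_mem_orthogonal x

end EDim

section Sufficient

variable {ι X Y : Type*} [NormedAddCommGroup X] [InnerProductSpace ℂ X]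
  [NormedAddCommGroup Y] [InnerProductSpace ℂ Y]
  {p : ι → X →L[ℂ] X} {q : ι → Y →L[ℂ] Y} {i j k l : ι}

theorem Tri.exists_inverse [CompleteSpace X] {η : X →L[ℂ] X} (hη : Tri p p η)
    (hid : Tri p p (ContinuousLinearMap.id ℂ X)) (hn : ‖η‖ ≤ 1 / 2) :
    ∃ Θ : X →L[ℂ] X, Tri p p Θ ∧ ‖Θ‖ ≤ 2 ∧ ∀ x, Θ x + η (Θ x) = x := by
  have h1 : ‖-η‖ < 1 := by rw [norm_neg]; linarith
  have hs := summable_geometric_of_norm_lt_one h1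
  have hpow : ∀ m : ℕ, Tri p p ((-η) ^ m) := fun m => by
    induction m with
    | zero => exact hid
    | succ m ih =>
      rw [pow_succ]
      refine ih.comp ?_
      rw [← neg_one_smul ℂ]
      exact hη.smul _
  have hΘ : ∀ x, (∑' m : ℕ, (-η) ^ m) x + η ((∑' m : ℕ, (-η) ^ m) x) = x := fun x => by
    have := congrArg (fun T : X →L[ℂ] X => T x) (mul_neg_geom_series (-η) h1)
    simpa [add_mul] using this
  refine ⟨∑' m : ℕ, (-η) ^ m, Tri.of_hasSum hpow fun x => ?_, ?_, hΘ⟩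
  · exact hs.hasSum.mapL (ContinuousLinearMap.apply ℂ X x)
  · refine ContinuousLinearMap.opNorm_le_bound _ zero_le_two fun x => ?_
    have h2 := norm_sub_le x (η ((∑' m : ℕ, (-η) ^ m) x))
    rw [← eq_sub_of_add_eq (hΘ x)] at h2
    have h3 := η.le_of_opNorm_le hn ((∑' m : ℕ, (-η) ^ m) x)
    linarith

/-- `Δ` and `C` are concentrated on the interval `(i, j]` of the nests, and `C` is a right inverse
of `A + Δ` there. -/
structure GoodPair (p : ι → X →L[ℂ] X) (q : ι → Y →L[ℂ] Y) (A : Y →L[ℂ] X) (i j : ι)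
    (Δ : Y →L[ℂ] X) (C : X →L[ℂ] Y) : Prop where
  tri_left : Tri q p Δ
  tri_right : Tri p q C
  gap_left : ∀ x, gap p i j (Δ x) = Δ x
  left_gap : ∀ x, Δ (gap q i j x) = Δ x
  gap_right : ∀ x, gap q i j (C x) = C x
  right_gap : ∀ x, C (gap p i j x) = C x
  gap_apply : ∀ x, gap p i j (A (C x)) + Δ (C x) = gap p i j x

/-- On the interval `(i, j]`, the operator `A` has a right invertible `ε`-perturbation with right
inverse of norm at most `κ`. -/
def Good (p : ι → X →L[ℂ] X) (q : ι → Y →L[ℂ] Y) (A : Y →L[ℂ] X) (i j : ι) (ε κ : ℝ) : Prop :=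
  ∃ Δ C, GoodPair p q A i j Δ C ∧ ‖Δ‖ ≤ ε ∧ ‖C‖ ≤ κ

theorem Good.mono {A : Y →L[ℂ] X} {ε ε' κ κ' : ℝ} (h : Good p q A i j ε κ) (hε : ε ≤ ε')
    (hκ : κ ≤ κ') : Good p q A i j ε' κ' := by
  obtain ⟨Δ, C, h1, h2, h3⟩ := h
  exact ⟨Δ, C, h1, h2.trans hε, h3.trans hκ⟩

theorem Good.self {A : Y →L[ℂ] X} {ε κ : ℝ} (hε : 0 ≤ ε) (hκ : 0 ≤ κ) : Good p q A i i ε κ :=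
  ⟨0, 0, ⟨Tri.zero, Tri.zero, by simp, by simp, by simp, by simp, by simp [gap_self]⟩,
    by simpa using hε, by simpa using hκ⟩

variable [LinearOrder ι]

theorem ProjNest.norm_gap_le (hp : ProjNest p) (hij : i ≤ j) : ‖gap p i j‖ ≤ 1 :=
  ContinuousLinearMap.opNorm_le_bound _ zero_le_one fun x => by
    rw [one_mul]; exact hp.norm_gap_apply_le hij x

/-- Uniformly bounded operators between disjoint intervals of two nests can be summed. -/
theorem ProjNest.exists_blockSum {κ : Type*} [CompleteSpace Y] (hp : ProjNest p) (hq : ProjNest q)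
    (T : κ → X →L[ℂ] Y) (a b a' b' : κ → ι) {c : ℝ} (hc : 0 ≤ c)
    (hab : ∀ m, a m ≤ b m) (hab' : ∀ m, a' m ≤ b' m)
    (hd : ∀ m m', m ≠ m' → b m ≤ a m' ∨ b m' ≤ a m)
    (hd' : ∀ m m', m ≠ m' → b' m ≤ a' m' ∨ b' m' ≤ a' m)
    (hT : ∀ m x, T m (gap p (a m) (b m) x) = T m x)
    (hT' : ∀ m x, gap q (a' m) (b' m) (T m x) = T m x) (hn : ∀ m, ‖T m‖ ≤ c) :
    ∃ S : X →L[ℂ] Y, ‖S‖ ≤ c ∧ (∀ x, HasSum (fun m => T m x) (S x)) ∧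
      ∀ m x, S (gap p (a m) (b m) x) = T m x := by
  obtain ⟨S, h1, h2, -⟩ := exists_hasSum_of_orthogonal T (fun m => gap p (a m) (b m)) hc
    (fun m m' hm x => by
      rw [← hT', hq.gap_inner_left, ← hT' m', hq.gap_gap_of_disjoint (hab' m) (hab' m')
        (hd' m m' hm), inner_zero_right])
    (hp.sum_norm_gap_sq_le a b hab hd)
    (fun m x => by rw [← hT]; exact (T m).le_of_opNorm_le (hn m) _)
  refine ⟨S, h1, h2, fun m x => ?_⟩
  rw [← hT]
  refine (h2 _).unique (hasSum_single m fun m' hm => ?_)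
  rw [← hT, hp.gap_gap_of_disjoint (hab m') (hab m) (hd m' m hm), map_zero]

theorem GoodPair.gap_apply_of_le (hp : ProjNest p) (hq : ProjNest q) {A A₁ Δ : Y →L[ℂ] X}
    {C : X →L[ℂ] Y} (h : GoodPair p q A i j Δ C) (hA₁ : Tri q p A₁)
    (hA₁C : ∀ x, A₁ (C x) = A (C x) + Δ (C x)) (hij : i ≤ j) (hjl : j ≤ l) (x : X) :
    gap p k l (A₁ (C x)) = gap p k i (A₁ (C x)) + gap p i j x := by
  have h1 : gap p j l (A₁ (C x)) = 0 := by
    rw [← h.gap_right, ← hq.apply_gap_of_ge le_rfl hij, hA₁.gap_apply_eq_zero hp hjl le_rfl]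
  have h2 : gap p i j (A₁ (C x)) = gap p i j x := by
    rw [hA₁C, map_add, h.gap_left, h.gap_apply]
  rw [← gap_add_gap (j := i), ← gap_add_gap (i := i) (j := j), h1, h2, add_zero]

theorem Good.of_tri (hp : ProjNest p) (hq : ProjNest q) {A Δ : Y →L[ℂ] X} {C : X →L[ℂ] Y}
    {ε κ : ℝ} (hA : Tri q p A) (hΔ : Tri q p Δ) (hC : Tri p q C) (hij : i ≤ j) (hε : ‖Δ‖ ≤ ε)
    (hκ : ‖C‖ ≤ κ) (h : ∀ x, gap p i j (A (C (gap p i j x)) + Δ (C (gap p i j x))) = gap p i j x) :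
    Good p q A i j ε κ := by
  refine ⟨gap p i j ∘L Δ ∘L gap q i j, gap q i j ∘L C ∘L gap p i j,
    ⟨((Tri.of_gap hp i j).comp hΔ).comp (Tri.of_gap hq i j),
      ((Tri.of_gap hq i j).comp hC).comp (Tri.of_gap hp i j), ?_, ?_, ?_, ?_, ?_⟩, ?_, ?_⟩
  · simp [hp.gap_idem hij]
  · simp [hq.gap_idem hij]
  · simp [hq.gap_idem hij]
  · simp [hp.gap_idem hij]
  · intro x
    simp only [ContinuousLinearMap.comp_apply, hq.gap_idem hij, hA.gap_comp hp hp hC hij,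
      hΔ.gap_comp hp hp hC hij]
    rw [← map_add, h]
  · refine (ContinuousLinearMap.opNorm_comp_le _ _).trans ?_
    refine (mul_le_mul (hp.norm_gap_le hij) (ContinuousLinearMap.opNorm_comp_le _ _)
      (norm_nonneg _) zero_le_one).trans ?_
    nlinarith [hq.norm_gap_le hij, norm_nonneg Δ]
  · refine (ContinuousLinearMap.opNorm_comp_le _ _).trans ?_
    refine (mul_le_mul (hq.norm_gap_le hij) (ContinuousLinearMap.opNorm_comp_le _ _)
      (norm_nonneg _) zero_le_one).trans ?_
    nlinarith [hp.norm_gap_le hij, norm_nonneg C]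

theorem Good.of_covBy [CompleteSpace X] [CompleteSpace Y] [TopologicalSpace.SeparableSpace X]
    (hp : ProjNest p) (hq : ProjNest q) {A : Y →L[ℂ] X} (hA : Tri q p A) (hij : i ⋖ j)
    (hfin : edim (blk p i j) ≠ ⊤) (hpq : 2 * edim (blk p i j) ≤ edim (blk q i j)) {ε : ℝ}
    (hε : 0 < ε) : Good p q A i j ε ε⁻¹ := by
  have hle := hij.le
  have hdim : edim (blk p i j) ≤
      edim (blk q i j ⊓ LinearMap.ker (gap p i j ∘L A : Y →L[ℂ] X).toLinearMap) :=
    le_edim_inf_ker (W := blk p i j) (fun x _ => hp.gap_mem_blk hle _) le_rfl hfin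
      (by rwa [← two_mul])
  obtain ⟨G, V, hG, hV, hGT, hVS, hG0, hV0, hVG⟩ := exists_partialIsometry_pair _ _
    isClosed_blk (isClosed_blk.inter (ContinuousLinearMap.isClosed_ker _)) hdim
  have hG0' : ∀ x, G (p i x) = 0 := fun x => hG0 _ ((hp.mem_blk_orthogonal hle).2
    (hp.gap_apply_of_le le_rfl hle x))
  have hV0' : ∀ x, V (q i x) = 0 := fun x => hV0 _ (Submodule.orthogonal_le inf_le_left
    ((hq.mem_blk_orthogonal hle).2 (hq.gap_apply_of_le le_rfl hle x)))
  have hGg : ∀ x, gap q i j (G x) = G x := fun x => mem_blk.1 (hGT x).1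
  have hVg : ∀ x, gap p i j (V x) = V x := fun x => mem_blk.1 (hVS x)
  have hGt : Tri p q G := Tri.of_covBy hp hq hij hG0' fun x => by
    rw [← hGg, hq.apply_gap_of_ge le_rfl hle]
  have hVt : Tri q p V := Tri.of_covBy hq hp hij hV0' fun x => by
    rw [← hVg, hp.apply_gap_of_ge le_rfl hle]
  refine Good.of_tri (Δ := (ε : ℂ) • V) (C := ((ε⁻¹ : ℝ) : ℂ) • G) hp hq hA (hVt.smul _)
    (hGt.smul _) hle ?_ ?_ fun x => ?_
  · rw [norm_smul, Complex.norm_of_nonneg hε.le]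
    nlinarith
  · rw [norm_smul, Complex.norm_of_nonneg (inv_pos.2 hε).le]
    nlinarith [inv_pos.2 hε]
  · have h1 : ∀ y, gap p i j (A (G y)) = 0 := fun y => (hGT y).2
    have h2 := (hp.mem_blk_orthogonal hle).1 (hVG (gap p i j x))
    rw [map_sub, hVg, hp.gap_idem hle, sub_eq_zero] at h2
    have hε' : (ε : ℂ) ≠ 0 := by exact_mod_cast hε.ne'
    simp only [smul_apply, map_smul, map_add, h1, smul_zero, zero_add, ← h2, smul_smul]
    rw [Complex.ofReal_inv, inv_mul_cancel₀ hε', one_smul, hp.gap_idem hle]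

theorem Good.trans [CompleteSpace X] (hp : ProjNest p) (hq : ProjNest q) {A : Y →L[ℂ] X}
    (hA : Tri q p A) (hij : i ≤ j) (hjk : j ≤ k) {ε κ₁ κ₂ : ℝ} (h₁ : Good p q A i j ε κ₁)
    (h₂ : Good p q A j k ε κ₂) : Good p q A i k ε (κ₁ + κ₂ + κ₁ * (‖A‖ + ε) * κ₂) := by
  obtain ⟨Δ₁, C₁, h1, hΔ1, hC1⟩ := h₁
  obtain ⟨Δ₂, C₂, h2, hΔ2, hC2⟩ := h₂
  obtain ⟨Δ, hΔ, hs, hsb⟩ := hq.exists_blockSum hp (fun b : Bool => cond b Δ₂ Δ₁)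
    (fun b => cond b j i) (fun b => cond b k j) (fun b => cond b j i) (fun b => cond b k j)
    (c := ε) ((norm_nonneg _).trans hΔ1)
    (by rintro (_ | _) <;> simpa) (by rintro (_ | _) <;> simpa)
    (by rintro (_ | _) (_ | _) <;> simp) (by rintro (_ | _) (_ | _) <;> simp)
    (by rintro (_ | _) x; exacts [h1.left_gap x, h2.left_gap x])
    (by rintro (_ | _) x; exacts [h1.gap_left x, h2.gap_left x])
    (by rintro (_ | _); exacts [hΔ1, hΔ2])
  have hΔt : Tri q p Δ := Tri.of_hasSum (by rintro (_ | _); exacts [h1.tri_left, h2.tri_left]) hs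
  have e1 : ∀ x, Δ (C₁ x) = Δ₁ (C₁ x) := fun x => by
    rw [← h1.gap_right]; exact (hsb false _).trans (h1.left_gap _).symm
  have e2 : ∀ x, Δ (C₂ x) = Δ₂ (C₂ x) := fun x => by
    rw [← h2.gap_right]; exact (hsb true _).trans (h2.left_gap _).symm
  have hAΔ := hA.add hΔt
  have e1' : ∀ x, gap p i k ((A + Δ) (C₁ x)) = gap p i j x := fun x => by
    rw [h1.gap_apply_of_le hp hq hAΔ (fun x => by rw [add_apply, e1]) hij hjk, gap_self, zero_add]
  have e2' : ∀ x, gap p i k ((A + Δ) (C₂ x)) = gap p i j ((A + Δ) (C₂ x)) + gap p j k x :=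
    fun x => h2.gap_apply_of_le hp hq hAΔ (fun x => by rw [add_apply, e2]) hjk le_rfl x
  refine Good.of_tri (Δ := Δ) (C := C₁ + C₂ - C₁ ∘L (A + Δ) ∘L C₂) hp hq hA hΔt
    ((h1.tri_right.add h2.tri_right).sub (h1.tri_right.comp (hAΔ.comp h2.tri_right)))
    (hij.trans hjk) hΔ ?_ fun x => ?_
  · have hκ₁ : 0 ≤ κ₁ := (norm_nonneg _).trans hC1
    refine (norm_sub_le _ _).trans (add_le_add ((norm_add_le _ _).trans (add_le_add hC1 hC2)) ?_)
    refine (ContinuousLinearMap.opNorm_comp_le _ _).trans ?_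
    rw [mul_assoc]
    refine mul_le_mul hC1 ((ContinuousLinearMap.opNorm_comp_le _ _).trans ?_) (norm_nonneg _) hκ₁
    have h3 : ‖A + Δ‖ ≤ ‖A‖ + ε := (norm_add_le _ _).trans (by gcongr)
    exact mul_le_mul h3 hC2 (norm_nonneg _) ((norm_nonneg _).trans h3)
  · rw [← add_apply, sub_apply, add_apply _ _ (gap p i k x), ContinuousLinearMap.comp_apply,
      ContinuousLinearMap.comp_apply, map_sub, map_add, map_sub, map_add, e1', e2', e1',
      add_sub_assoc, add_sub_cancel_left, gap_add_gap, hp.gap_idem (hij.trans hjk)]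

end Sufficient

section Limit

variable {ι X Y Z : Type*} [NormedAddCommGroup X] [InnerProductSpace ℂ X]
  [NormedAddCommGroup Y] [InnerProductSpace ℂ Y] [NormedAddCommGroup Z] [InnerProductSpace ℂ Z]
  {p : ι → X →L[ℂ] X} {q : ι → Y →L[ℂ] Y}

theorem eq_of_eq_gap {k : ℕ → ι} {s : ι}
    (hlim : ∀ x, Filter.Tendsto (fun j => p (k j) x) Filter.atTop (nhds (p s x)))
    {S T : X →L[ℂ] Z} (h : ∀ j x, S (gap p (k j) (k (j + 1)) x) = T (gap p (k j) (k (j + 1)) x))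
    (x : X) : S (gap p (k 0) s x) = T (gap p (k 0) s x) := by
  have h1 : ∀ j, S (gap p (k 0) (k j) x) = T (gap p (k 0) (k j) x) := fun j => by
    induction j with
    | zero => rw [gap_self, map_zero, map_zero]
    | succ j ih => rw [← gap_add_gap (j := k j), map_add, map_add, ih, h]
  have h2 : ∀ R : X →L[ℂ] Z, Filter.Tendsto (fun j => R (gap p (k 0) (k j) x)) Filter.atTop
      (nhds (R (gap p (k 0) s x))) := fun R =>
    (R.continuous.tendsto _).comp ((hlim x).sub_const _)
  refine tendsto_nhds_unique (h2 S) ?_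
  simp only [h1]
  exact h2 T

variable [LinearOrder ι]

theorem Good.of_monotone [CompleteSpace X] [CompleteSpace Y] [TopologicalSpace.SeparableSpace X]
    (hp : ProjNest p) (hq : ProjNest q)
    (hpq : ∀ i j, i ≤ j → 2 * edim (blk p i j) ≤ edim (blk q i j))
    {A : Y →L[ℂ] X} (hA : Tri q p A) {ε κ : ℝ} (hε : 0 < ε) (hκ : 0 ≤ κ) :
    ∃ κ', ∀ (k : ℕ → ι) (s : ι), Monotone k → (∀ j, k j ≤ s) →
      (∀ x, Filter.Tendsto (fun j => p (k j) x) Filter.atTop (nhds (p s x))) →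
      (∀ j, Good p q A (k j) (k (j + 1)) ε κ) → (∀ j, edim (blk p (k 0) (k j)) ≠ ⊤) →
      (∀ j, k (j + 1) = k (j + 2) ∨
        2 * edim (blk p (k 0) (k j)) ≤ edim (blk p (k j) (k (j + 1)))) →
      Good p q A (k 0) s (2 * ε) κ' := by
  set ρ : ℝ := (‖A‖ + ε) * κ with hρ
  have hρ0 : 0 ≤ ρ := by positivity
  set u : ℝ := ρ * (1 + ρ) + 1 with hu
  have hu0 : 0 < u := by positivity
  set t : ℝ := u / ε + 2 * (u * (κ * (1 + ρ))) with ht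
  have ht0 : 0 < t := by positivity
  refine ⟨(κ * (1 + ρ) + t) * 2, fun k s hk hks hlim hgood hfin hdim => ?_⟩
  have hk1 : ∀ j, k j ≤ k (j + 1) := fun j => hk j.le_succ
  have hk2 : ∀ j, k (j + 1) ≤ k (j + 1 + 1) := fun j => hk1 _
  have hk0 : ∀ j, k 0 ≤ k j := fun j => hk j.zero_le
  have hd : ∀ m m' : ℕ, m ≠ m' → k (m + 1) ≤ k m' ∨ k (m' + 1) ≤ k m := fun m m' hm =>
    (lt_or_gt_of_ne hm).imp (fun h => hk h) fun h => hk h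
  have hd2 : ∀ m m' : ℕ, m ≠ m' → k (m + 1 + 1) ≤ k (m' + 1) ∨ k (m' + 1 + 1) ≤ k (m + 1) :=
    fun m m' hm => hd _ _ (by omega)
  choose Δ C hG hΔn hCn using hgood
  obtain ⟨D, hDn, hDs, hDb⟩ := hq.exists_blockSum hp Δ (fun j => k j) (fun j => k (j + 1))
    (fun j => k j) (fun j => k (j + 1)) hε.le hk1 hk1 hd hd (fun m => (hG m).left_gap)
    (fun m => (hG m).gap_left) hΔn
  obtain ⟨W, hWn, hWs, hWb⟩ := hp.exists_blockSum hq C (fun j => k j) (fun j => k (j + 1))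
    (fun j => k j) (fun j => k (j + 1)) hκ hk1 hk1 hd hd (fun m => (hG m).right_gap)
    (fun m => (hG m).gap_right) hCn
  have hDt : Tri q p D := Tri.of_hasSum (fun m => (hG m).tri_left) hDs
  have hWt : Tri p q W := Tri.of_hasSum (fun m => (hG m).tri_right) hWs
  set A₁ := A + D with hA₁
  have hA₁t : Tri q p A₁ := hA.add hDt
  have hA₁n : ‖A₁‖ ≤ ‖A‖ + ε := (norm_add_le _ _).trans (by gcongr)
  have hDC : ∀ j x, A₁ (C j x) = A (C j x) + Δ j (C j x) := fun j x => by
    rw [hA₁, add_apply, ← (hG j).gap_right, hDb, (hG j).left_gap]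
  set E := gap p (k 0) s with hE
  have hks0 := hks 0
  have hEE : ∀ x, E (E x) = E x := hp.gap_idem hks0
  have hAC : ∀ j x, E (A₁ (C j x)) =
      gap p (k 0) (k j) (A₁ (C j x)) + gap p (k j) (k (j + 1)) x := fun j x =>
    (hG j).gap_apply_of_le hp hq hA₁t (hDC j) (hk1 j) (hks _) x
  -- the first off-diagonal of `A₁ W`
  let Yb : ℕ → X →L[ℂ] X := fun j => gap p (k j) (k (j + 1)) ∘L A₁ ∘L C (j + 1)
  have hYg : ∀ j x, gap p (k j) (k (j + 1)) (Yb j x) = Yb j x := fun j x => hp.gap_idem (hk1 j) _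
  have hYg' : ∀ j x, Yb j (gap p (k (j + 1)) (k (j + 1 + 1)) x) = Yb j x := fun j x => by
    simp only [Yb, ContinuousLinearMap.comp_apply, (hG (j + 1)).right_gap]
  obtain ⟨Yo, hYn, hYs, hYb⟩ := hp.exists_blockSum hp Yb (fun j => k (j + 1))
    (fun j => k (j + 1 + 1)) (fun j => k j) (fun j => k (j + 1)) hρ0 hk2 hk1 hd2 hd hYg' hYg
    (fun m => by
      refine (ContinuousLinearMap.opNorm_comp_le _ _).trans ?_
      refine (mul_le_mul (hp.norm_gap_le (hk1 m)) (ContinuousLinearMap.opNorm_comp_le _ _)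
        (norm_nonneg _) zero_le_one).trans ?_
      rw [one_mul]
      exact mul_le_mul hA₁n (hCn _) (norm_nonneg _) (by positivity))
  have hYt : Tri p p Yo := Tri.of_hasSum (fun m => Tri.of_le hp hp le_rfl
    (fun x => by rw [← hYg', hp.gap_apply_of_le le_rfl (hk2 m), map_zero])
    (fun x => by rw [← hYg, hp.apply_gap_of_ge le_rfl (hk1 m)])) hYs
  have hY0 : ∀ x, Yo (gap p (k 0) (k (0 + 1)) x) = 0 := fun x => by
    refine (hYs _).unique ?_
    convert hasSum_zero with m
    rw [← hYg', hp.gap_gap_of_disjoint (hk2 m) (hk1 0) (Or.inr (hk (by omega))), map_zero]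
  let R : X →L[ℂ] X := E - Yo
  have hRt : Tri p p R := (Tri.of_gap hp _ _).sub hYt
  have hRn : ‖R‖ ≤ 1 + ρ := (norm_sub_le _ _).trans (add_le_add (hp.norm_gap_le hks0) hYn)
  have hERj : ∀ j x, E (gap p (k j) (k (j + 1)) x) = gap p (k j) (k (j + 1)) x := fun j x =>
    hp.gap_gap_of_subset' (hk0 j) (hk1 j) (hks _) x
  let B : X →L[ℂ] X := E ∘L A₁ ∘L W
  have hBt : Tri p p B := (Tri.of_gap hp _ _).comp (hA₁t.comp hWt)
  have hBn : ‖B‖ ≤ ρ := by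
    refine (ContinuousLinearMap.opNorm_comp_le _ _).trans ?_
    refine (mul_le_mul (hp.norm_gap_le hks0) (ContinuousLinearMap.opNorm_comp_le _ _)
      (norm_nonneg _) zero_le_one).trans ?_
    rw [one_mul]
    exact mul_le_mul hA₁n hWn (norm_nonneg _) (by positivity)
  have hBj : ∀ j x, B (gap p (k j) (k (j + 1)) x) =
      gap p (k 0) (k j) (A₁ (C j x)) + gap p (k j) (k (j + 1)) x := fun j x => by
    simp only [B, ContinuousLinearMap.comp_apply, hWb, hAC]
  let U : X →L[ℂ] X := B ∘L R - E
  have hUt : Tri p p U := (hBt.comp hRt).sub (Tri.of_gap hp _ _)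
  have hUn : ‖U‖ ≤ u := by
    refine (norm_sub_le _ _).trans (add_le_add ?_ (hp.norm_gap_le hks0))
    exact (ContinuousLinearMap.opNorm_comp_le _ _).trans
      (mul_le_mul hBn hRn (norm_nonneg _) hρ0)
  have hEU : ∀ x, E (U x) = U x := fun x => by
    simp only [U, B, sub_apply, ContinuousLinearMap.comp_apply, map_sub, hEE]
  have hU0 : ∀ x, U (gap p (k 0) (k (0 + 1)) x) = 0 := fun x => by
    simp only [U, R, sub_apply, ContinuousLinearMap.comp_apply, hY0, sub_zero, hERj, hBj,
      gap_self, zero_add, sub_self]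
  have hUj : ∀ j x, gap p (k 0) (k j) (U (gap p (k (j + 1)) (k (j + 1 + 1)) x)) =
      U (gap p (k (j + 1)) (k (j + 1 + 1)) x) := fun j x => by
    have : U (gap p (k (j + 1)) (k (j + 1 + 1)) x) =
        gap p (k 0) (k j) (A₁ (C (j + 1) x) - A₁ (C j (Yb j x))) := by
      simp only [U, R, sub_apply, ContinuousLinearMap.comp_apply, hERj, hYb, map_sub]
      rw [hBj, ← hYg, hBj, hYg, ← gap_add_gap (i := k 0) (j := k j) (k := k (j + 1))]
      simp only [Yb, ContinuousLinearMap.comp_apply]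
      abel
    rw [this, hp.gap_idem (hk0 j)]
  -- partial isometries to correct the remaining error `U`
  have hpair : ∀ j, ∃ (G : X →L[ℂ] Y) (V : Y →L[ℂ] X), ‖G‖ ≤ 1 ∧ ‖V‖ ≤ 1 ∧
      (∀ x, G (gap p (k (j + 1)) (k (j + 1 + 1)) x) = G x) ∧
      (∀ x, gap q (k j) (k (j + 1)) (G x) = G x) ∧
      (∀ y, V (gap q (k j) (k (j + 1)) y) = V y) ∧
      (∀ y, gap p (k (j + 1)) (k (j + 1 + 1)) (V y) = V y) ∧ (∀ x, E (A₁ (G x)) = 0) ∧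
      ∀ x, U (V (G x)) = U (gap p (k (j + 1)) (k (j + 1 + 1)) x) := by
    intro j
    let T : X →L[ℂ] X := U ∘L gap p (k (j + 1)) (k (j + 1 + 1))
    have hTk : ∀ x, T (x - gap p (k (j + 1)) (k (j + 1 + 1)) x) = 0 := fun x => by
      simp only [T, ContinuousLinearMap.comp_apply, map_sub, hp.gap_idem (hk2 j), sub_self]
    have hSle : (LinearMap.ker T.toLinearMap)ᗮ ≤ blk p (k (j + 1)) (k (j + 1 + 1)) := by
      intro x hx
      rw [mem_blk, ← sub_eq_zero, ← neg_eq_zero, neg_sub, ← inner_self_eq_zero (𝕜 := ℂ)]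
      have h1 := hx _ (hTk x)
      have h2 : ⟪x - gap p (k (j + 1)) (k (j + 1 + 1)) x,
          gap p (k (j + 1)) (k (j + 1 + 1)) x⟫_ℂ = 0 := by
        rw [← hp.gap_inner_left, map_sub, hp.gap_idem (hk2 j), sub_self, inner_zero_left]
      rw [inner_sub_right, h1, h2, sub_zero]
    have hle : edim (LinearMap.ker T.toLinearMap)ᗮ ≤
        edim (blk q (k j) (k (j + 1)) ⊓ LinearMap.ker (E ∘L A₁ : Y →L[ℂ] X).toLinearMap) := by
      rcases hdim j with h | h
      · have : edim (LinearMap.ker T.toLinearMap)ᗮ = 0 := by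
          rw [edim_eq_zero_iff, eq_bot_iff]
          refine hSle.trans ?_
          rw [show k (j + 1 + 1) = k (j + 1) from h.symm, blk_self]
        rw [this]
        exact zero_le
      · refine (edim_ker_orthogonal_le T (W := blk p (k 0) (k j)) fun x =>
          mem_blk.2 (hUj j x)).trans ?_
        refine le_edim_inf_ker (W := blk p (k 0) (k (j + 1))) (fun y hy => ?_) le_rfl
          (hfin (j + 1)) ?_
        · rw [mem_blk]
          have h1 : q (k (j + 1)) y = y := by
            rw [← mem_blk.1 hy, hq.apply_gap_of_ge le_rfl (hk1 j)]
          simp only [ContinuousLinearMap.comp_apply]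
          rw [← hA₁t.apply_eq h1, hE, hp.gap_gap_of_subset le_rfl (hk0 _) (hks _), gap_apply,
            gap_apply, hp.apply_of_ge le_rfl, hp.apply_of_ge (hks _)]
        · refine le_trans ?_ (hpq _ _ (hk1 j))
          rw [← hp.edim_blk_add (hk0 j) (hk1 j), two_mul]
          calc _ = 2 * edim (blk p (k 0) (k j)) + edim (blk p (k j) (k (j + 1))) := by ring
            _ ≤ _ := by gcongr
    obtain ⟨G, V, hGn, hVn, hGT, hVS, hG0, hV0, hVG⟩ := exists_partialIsometry_pair _ _
      (Submodule.isClosed_orthogonal _) (isClosed_blk.inter (ContinuousLinearMap.isClosed_ker _))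
      hle
    have hkc : (LinearMap.ker T.toLinearMap)ᗮᗮ = LinearMap.ker T.toLinearMap := by
      have : CompleteSpace (LinearMap.ker T.toLinearMap) :=
        (ContinuousLinearMap.isClosed_ker T).completeSpace_coe
      exact Submodule.orthogonal_orthogonal _
    have hVg : ∀ y, gap p (k (j + 1)) (k (j + 1 + 1)) (V y) = V y := fun y =>
      mem_blk.1 (hSle (hVS y))
    refine ⟨G, V, hGn, hVn, fun x => ?_, fun x => mem_blk.1 (hGT x).1, fun y => ?_, hVg,
      fun x => (hGT x).2, fun x => ?_⟩
    · have := hG0 (x - gap p (k (j + 1)) (k (j + 1 + 1)) x) (by rw [hkc]; exact hTk x)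
      rw [map_sub, sub_eq_zero] at this
      exact this.symm
    · have := hV0 (y - gap q (k j) (k (j + 1)) y) (Submodule.orthogonal_le inf_le_left
        ((hq.mem_blk_orthogonal (hk1 j)).2 (by
          rw [map_sub, hq.gap_idem (hk1 j), sub_self])))
      rw [map_sub, sub_eq_zero] at this
      exact this.symm
    · have h1 := hVG x
      rw [hkc] at h1
      have h2 : T (x - V (G x)) = 0 := h1
      simp only [T, ContinuousLinearMap.comp_apply, map_sub, hVg, sub_eq_zero] at h2
      exact h2.symm
  choose Gb Vb hGn hVn hGg hGg' hVg hVg' hAG hUVG using hpair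
  obtain ⟨G, hGn', hGs, hGb⟩ := hp.exists_blockSum hq Gb (fun j => k (j + 1))
    (fun j => k (j + 1 + 1)) (fun j => k j) (fun j => k (j + 1)) zero_le_one hk2 hk1 hd2 hd
    hGg hGg' hGn
  obtain ⟨V, hVn', hVs, hVb⟩ := hq.exists_blockSum hp Vb (fun j => k j) (fun j => k (j + 1))
    (fun j => k (j + 1)) (fun j => k (j + 1 + 1)) zero_le_one hk1 hk2 hd hd2 hVg hVg' hVn
  have hGt : Tri p q G := Tri.of_hasSum (fun m => Tri.of_le hp hq le_rfl
    (fun x => by rw [← hGg, hp.gap_apply_of_le le_rfl (hk2 m), map_zero])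
    (fun x => by rw [← hGg', hq.apply_gap_of_ge le_rfl (hk1 m)])) hGs
  have hG0 : ∀ x, G (gap p (k 0) (k (0 + 1)) x) = 0 := fun x => by
    refine (hGs _).unique ?_
    convert hasSum_zero with m
    rw [← hGg, hp.gap_gap_of_disjoint (hk2 m) (hk1 0) (Or.inr (hk (by omega))), map_zero]
  have hUVt : Tri q p (U ∘L V) := by
    refine Tri.of_hasSum (T := fun m => U ∘L Vb m) (fun m => Tri.of_le hq hp (le_refl (k m))
      (fun x => ?_) fun x => ?_) fun x => (hVs x).mapL U
    · rw [ContinuousLinearMap.comp_apply, ← hVg, hq.gap_apply_of_le le_rfl (hk1 m), map_zero,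
        map_zero]
    · rw [ContinuousLinearMap.comp_apply, ← hVg', ← hUj, hp.apply_gap_of_ge le_rfl (hk0 m)]
  have hUVG' : ∀ x, U (V (G (E x))) = U (E x) := by
    refine fun x => eq_of_eq_gap (S := U ∘L V ∘L G) (T := U) hlim (fun j x => ?_) x
    cases j with
    | zero => simp only [ContinuousLinearMap.comp_apply, hG0, hU0, map_zero]
    | succ j =>
      simp only [ContinuousLinearMap.comp_apply]
      rw [hGb, ← hGg', hVb, hUVG]
  have hEAG : ∀ x, E (A₁ (G x)) = 0 := fun x => by
    have h1 := ((hGs x).mapL A₁).mapL E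
    simp only [hAG] at h1
    exact h1.unique hasSum_zero
  set η : X →L[ℂ] X := ((t⁻¹ : ℝ) : ℂ) • (U ∘L V ∘L W ∘L R) with hη
  have htn : ‖((t⁻¹ : ℝ) : ℂ)‖ = t⁻¹ := Complex.norm_of_nonneg (inv_pos.2 ht0).le
  have hUVn : ‖U ∘L V‖ ≤ u := (ContinuousLinearMap.opNorm_comp_le _ _).trans (by
    nlinarith [norm_nonneg U, norm_nonneg V])
  have hWRn : ‖W ∘L R‖ ≤ κ * (1 + ρ) := (ContinuousLinearMap.opNorm_comp_le _ _).trans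
    (mul_le_mul hWn hRn (norm_nonneg _) hκ)
  have hηn : ‖η‖ ≤ 1 / 2 := by
    rw [hη, norm_smul, htn, inv_mul_le_iff₀ ht0]
    have h1 : ‖U ∘L V ∘L W ∘L R‖ ≤ u * (κ * (1 + ρ)) := by
      change ‖(U ∘L V) ∘L (W ∘L R)‖ ≤ _
      exact (ContinuousLinearMap.opNorm_comp_le _ _).trans
        (mul_le_mul hUVn hWRn (norm_nonneg _) hu0.le)
    have h2 : 0 < u / ε := by positivity
    rw [ht]
    linarith
  have hηt : Tri p p η := (hUVt.comp (hWt.comp hRt)).smul _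
  obtain ⟨Θ, hΘt, hΘn, hΘ⟩ := hηt.exists_inverse (Tri.id hp) hηn
  let C' : X →L[ℂ] Y := W ∘L R - (t : ℂ) • G
  have hC't : Tri p q C' := (hWt.comp hRt).sub (hGt.smul _)
  have hC'n : ‖C'‖ ≤ κ * (1 + ρ) + t := by
    refine (norm_sub_le _ _).trans (add_le_add hWRn ?_)
    rw [norm_smul, Complex.norm_of_nonneg ht0.le]
    nlinarith
  let δ : Y →L[ℂ] X := ((t⁻¹ : ℝ) : ℂ) • (U ∘L V)
  have hδt : Tri q p δ := hUVt.smul _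
  have hδn : ‖δ‖ ≤ ε := by
    rw [norm_smul, htn, inv_mul_le_iff₀ ht0]
    refine hUVn.trans ?_
    have h2 : 0 ≤ 2 * (u * (κ * (1 + ρ))) := by positivity
    calc u = u / ε * ε := by field_simp
      _ ≤ t * ε := by gcongr; linarith
  have hYE : ∀ x, Yo (E x) = Yo x := fun x => by
    refine (hYs _).unique ?_
    convert hYs x using 2 with m
    rw [← hYg', hp.gap_gap_of_subset (hk0 _) (hk2 m) (hks _), hYg']
  have hRE : ∀ x, R (E x) = R x := fun x => by simp only [R, sub_apply, hEE, hYE]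
  have hUE : ∀ x, U (E x) = U x := fun x => by
    simp only [U, sub_apply, ContinuousLinearMap.comp_apply, hRE, hEE]
  have hGE : ∀ x, G (E x) = G x := fun x => by
    refine (hGs _).unique ?_
    convert hGs x using 2 with m
    rw [← hGg, hp.gap_gap_of_subset (hk0 _) (hk2 m) (hks _), hGg]
  have hEη : ∀ x, E (η x) = η x := fun x => by
    simp only [η, smul_apply, map_smul, ContinuousLinearMap.comp_apply, hEU]
  have hmain : ∀ x, E (A₁ (C' x) + δ (C' x)) = E x + η x := fun x => by
    have h1 : E (A₁ (C' x)) = U x + E x := by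
      simp only [C', U, B, sub_apply, ContinuousLinearMap.comp_apply, map_sub, smul_apply,
        map_smul, hEAG, smul_zero, sub_zero, sub_add_cancel]
    have h2 : δ (C' x) = η x - U x := by
      simp only [C', δ, η, sub_apply, ContinuousLinearMap.comp_apply, map_sub, smul_apply,
        map_smul, smul_smul]
      rw [← Complex.ofReal_mul, mul_inv_cancel₀ ht0.ne', Complex.ofReal_one, one_smul, ← hGE,
        hUVG', hUE]
    rw [map_add, h1, h2, map_sub, hEη, hEU]
    abel
  refine Good.of_tri hp hq hA (Δ := D + δ) (C := C' ∘L Θ) (hDt.add hδt) (hC't.comp hΘt) hks0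
    ?_ ?_ fun x => ?_
  · exact (norm_add_le _ _).trans (by linarith)
  · exact (ContinuousLinearMap.opNorm_comp_le _ _).trans
      (mul_le_mul hC'n hΘn (norm_nonneg _) (by positivity))
  · have h1 : A ((C' ∘L Θ) (E x)) + (D + δ) ((C' ∘L Θ) (E x)) =
        A₁ (C' (Θ (E x))) + δ (C' (Θ (E x))) := by
      simp only [A₁, add_apply, ContinuousLinearMap.comp_apply]
      abel
    rw [← hE, h1, hmain, ← hEη, ← map_add, hΘ, hEE]

end Limit

section Sufficient

variable {ι X Y : Type*} [LinearOrder ι] [NormedAddCommGroup X] [InnerProductSpace ℂ X]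
  [NormedAddCommGroup Y] [InnerProductSpace ℂ Y]
  {p : ι → X →L[ℂ] X} {q : ι → Y →L[ℂ] Y} {n : ℕ}

theorem ProjNest.edim_blk_lt (hp : ProjNest p) (hne : ∀ i j, i < j → blk p i j ≠ ⊥) {i j k : ι}
    (hij : i ≤ j) (hjk : j < k) (hfin : edim (blk p i j) ≠ ⊤) :
    edim (blk p i j) < edim (blk p i k) := by
  rw [← hp.edim_blk_add hij hjk.le]
  have h1 : 1 ≤ edim (blk p j k) :=
    Order.one_le_iff_ne_zero.2 fun h => hne _ _ hjk (edim_eq_zero_iff.1 h)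
  exact ((ENat.lt_add_one_iff hfin).2 le_rfl).trans_le (by gcongr)

theorem ProjNest.le_edim_of_strictMono (hp : ProjNest p) (hne : ∀ i j, i < j → blk p i j ≠ ⊥)
    {k : ℕ → ι} (hk : StrictMono k) (m : ℕ) : (m : ℕ∞) ≤ edim (blk p (k 0) (k m)) := by
  induction m with
  | zero => simp
  | succ m ih =>
    have h1 : k m < k (m + 1) := hk (by omega)
    rw [← hp.edim_blk_add (hk.monotone m.zero_le) h1.le, Nat.cast_add, Nat.cast_one]
    exact add_le_add ih (Order.one_le_iff_ne_zero.2 fun h => hne _ _ h1 (edim_eq_zero_iff.1 h))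

theorem ProjNest.exists_covBy (hp : ProjNest p) (hne : ∀ i j, i < j → blk p i j ≠ ⊥)
    {x y : ι} {D : ℕ∞} (hD : D ≠ ⊤) (hxy : x < y)
    (h : ∀ z, x ≤ z → z < y → edim (blk p x z) ≤ D) : ∃ z, x ≤ z ∧ z ⋖ y := by
  obtain ⟨d, rfl⟩ := ENat.ne_top_iff_exists.1 hD
  obtain ⟨z, ⟨hxz, hzy⟩, hz⟩ := exists_minimalFor_of_wellFoundedLT (· ∈ Set.Ico x y)
    (fun z => d - (edim (blk p x z)).toNat) ⟨x, le_rfl, hxy⟩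
  refine ⟨z, hxz, hzy, fun w hzw hwy => ?_⟩
  have hw := h w (hxz.trans hzw.le) hwy
  have hz' := h z hxz hzy
  have h1 := hp.edim_blk_lt hne hxz hzw (ne_top_of_le_ne_top hD hz')
  have h2 := @hz w ⟨hxz.trans hzw.le, hwy⟩
  simp only at h2
  obtain ⟨e, he⟩ := ENat.ne_top_iff_exists.1 (ne_top_of_le_ne_top hD hw)
  obtain ⟨e', he'⟩ := ENat.ne_top_iff_exists.1 (ne_top_of_le_ne_top hD hz')
  rw [← he, ← he'] at h1 h2
  rw [← he] at hw
  simp only [ENat.toNat_natCast] at h2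
  norm_cast at h1 hw
  omega

theorem three_mul_pow_le (hn : n ≠ 0) : 3 * n ^ (2 * n) ≤ (n + 1) ^ (2 * n) := by
  have h := one_add_mul_le_pow (a := (n : ℝ)⁻¹) (by
    have : (0 : ℝ) ≤ (n : ℝ)⁻¹ := by positivity
    linarith) (2 * n)
  have hn' : (n : ℝ) ≠ 0 := Nat.cast_ne_zero.2 hn
  have h1 : (1 : ℝ) + ((2 * n : ℕ) : ℝ) * (n : ℝ)⁻¹ = 3 := by
    push_cast
    field_simp
    norm_num
  rw [h1] at h
  have h2 : (n : ℝ) + 1 = n * (1 + (n : ℝ)⁻¹) := by field_simp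
  have h3 : (3 : ℝ) * n ^ (2 * n) ≤ (n + 1) ^ (2 * n) := by
    rw [h2, mul_pow, mul_comm]
    gcongr
  exact_mod_cast h3

/-- One step of the construction of a sequence of intervals of rapidly growing dimension. -/
theorem exists_good_step [WellFoundedLT ι] [CompleteSpace X] [CompleteSpace Y]
    [TopologicalSpace.SeparableSpace X] (hp : ProjNest p) (hq : ProjNest q)
    (hpq : ∀ i j, i ≤ j → 2 * edim (blk p i j) ≤ edim (blk q i j))
    (hne : ∀ i j, i < j → blk p i j ≠ ⊥) (hcov : ∀ i j, i ⋖ j → edim (blk p i j) ≠ ⊤)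
    (hn : n ≠ 0) {A : Y →L[ℂ] X} (hA : Tri q p A) {ε κ : ℝ} (hε : 0 < ε) (hκ : 0 ≤ κ) {a b : ι}
    (hshort : ∀ x w, a ≤ x → x ≤ w → w ≤ b → n * edim (blk p x w) ≤ edim (blk p a x) →
      Good p q A x w ε κ) {x : ι} (hax : a ≤ x) (hxb : x ≤ b) (hx : edim (blk p a x) ≠ ⊤) :
    Good p q A x b ε (κ + ε⁻¹ + κ * (‖A‖ + ε) * ε⁻¹) ∨
      ∃ y, x < y ∧ y ≤ b ∧ edim (blk p a y) ≠ ⊤ ∧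
        (n + 1) * edim (blk p a x) ≤ n * edim (blk p a y) ∧
        Good p q A x y ε (κ + ε⁻¹ + κ * (‖A‖ + ε) * ε⁻¹) := by
  by_cases h : n * edim (blk p x b) ≤ edim (blk p a x)
  · refine Or.inl ((hshort x b hax hxb le_rfl h).mono le_rfl ?_)
    have : 0 ≤ ε⁻¹ + κ * (‖A‖ + ε) * ε⁻¹ := by positivity
    linarith
  right
  obtain ⟨y, ⟨hxy, hy⟩, hmin⟩ := WellFounded.has_min (wellFounded_lt (α := ι))
    {y | x ≤ y ∧ edim (blk p a x) < n * edim (blk p x y)} ⟨b, hxb, not_le.1 h⟩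
  have hyb : y ≤ b := not_lt.1 (hmin b ⟨hxb, not_le.1 h⟩)
  have hxy' : x < y := by
    refine lt_of_le_of_ne hxy ?_
    rintro rfl
    rw [blk_self, edim_eq_zero_iff.2 rfl, mul_zero] at hy
    exact not_lt_zero hy
  have hlt : ∀ z, x ≤ z → z < y → n * edim (blk p x z) ≤ edim (blk p a x) := fun z h1 h2 =>
    not_lt.1 fun h3 => hmin z ⟨h1, h3⟩ h2
  have hlt' : ∀ z, x ≤ z → z < y → edim (blk p x z) ≤ edim (blk p a x) := fun z h1 h2 =>
    le_trans (le_mul_of_one_le_left zero_le (by exact_mod_cast Nat.one_le_iff_ne_zero.2 hn))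
      (hlt z h1 h2)
  obtain ⟨z, hxz, hzy⟩ := hp.exists_covBy hne hx hxy' hlt'
  have hfz : edim (blk p x z) ≠ ⊤ := ne_top_of_le_ne_top hx (hlt' z hxz hzy.lt)
  refine ⟨y, hxy', hyb, ?_, ?_, (hshort x z hax hxz (hzy.le.trans hyb)
    (hlt z hxz hzy.lt)).trans hp hq hA hxz hzy.le
    (Good.of_covBy hp hq hA hzy (hcov _ _ hzy) (hpq _ _ hzy.le) hε)⟩
  · rw [← hp.edim_blk_add hax hxy, ← hp.edim_blk_add hxz hzy.le]
    simp only [ne_eq, ENat.add_eq_top, not_or]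
    exact ⟨hx, hfz, hcov _ _ hzy⟩
  · rw [← hp.edim_blk_add hax hxy, mul_add, add_mul, one_mul]
    gcongr

theorem exists_good_steps [WellFoundedLT ι] [CompleteSpace X] [CompleteSpace Y]
    [TopologicalSpace.SeparableSpace X] (hp : ProjNest p) (hq : ProjNest q)
    (hpq : ∀ i j, i ≤ j → 2 * edim (blk p i j) ≤ edim (blk q i j))
    (hne : ∀ i j, i < j → blk p i j ≠ ⊥) (hcov : ∀ i j, i ⋖ j → edim (blk p i j) ≠ ⊤)
    (hn : n ≠ 0) {A : Y →L[ℂ] X} (hA : Tri q p A) {ε κ : ℝ} (hε : 0 < ε) (hκ : 0 ≤ κ) (m : ℕ) :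
    ∃ κ' ≥ 0, ∀ a b : ι, (∀ x w, a ≤ x → x ≤ w → w ≤ b →
      n * edim (blk p x w) ≤ edim (blk p a x) → Good p q A x w ε κ) →
      ∀ x, a ≤ x → x ≤ b → edim (blk p a x) ≠ ⊤ → Good p q A x b ε κ' ∨
        ∃ y, x < y ∧ y ≤ b ∧ edim (blk p a y) ≠ ⊤ ∧
          (n + 1) ^ (m + 1) * edim (blk p a x) ≤ n ^ (m + 1) * edim (blk p a y) ∧
          Good p q A x y ε κ' := by
  set κ₁ := κ + ε⁻¹ + κ * (‖A‖ + ε) * ε⁻¹ with hκ₁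
  have hκ₁0 : 0 ≤ κ₁ := by positivity
  induction m with
  | zero =>
    refine ⟨κ₁, hκ₁0, fun a b hshort x hax hxb hx => ?_⟩
    simpa only [zero_add, pow_one] using
      exists_good_step hp hq hpq hne hcov hn hA hε hκ hshort hax hxb hx
  | succ m ih =>
    obtain ⟨κ', hκ', h⟩ := ih
    have hle : κ' ≤ κ' + κ₁ + κ' * (‖A‖ + ε) * κ₁ := by
      have : 0 ≤ κ' * (‖A‖ + ε) * κ₁ := by positivity
      linarith
    refine ⟨κ' + κ₁ + κ' * (‖A‖ + ε) * κ₁, hκ'.trans hle, fun a b hshort x hax hxb hx => ?_⟩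
    rcases h a b hshort x hax hxb hx with h1 | ⟨y, hxy, hyb, hy, hd, hg⟩
    · exact Or.inl (h1.mono le_rfl hle)
    rcases exists_good_step hp hq hpq hne hcov hn hA hε hκ hshort (hax.trans hxy.le) hyb hy with
      h2 | ⟨z, hyz, hzb, hz, hd', hg'⟩
    · exact Or.inl (hg.trans hp hq hA hxy.le hyb h2)
    · refine Or.inr ⟨z, hxy.trans hyz, hzb, hz, ?_, hg.trans hp hq hA hxy.le hyz.le hg'⟩
      calc ((n : ℕ∞) + 1) ^ (m + 1 + 1) * edim (blk p a x)
          = (n + 1) * ((n + 1) ^ (m + 1) * edim (blk p a x)) := by ring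
        _ ≤ (n + 1) * (n ^ (m + 1) * edim (blk p a y)) := by gcongr
        _ = n ^ (m + 1) * ((n + 1) * edim (blk p a y)) := by ring
        _ ≤ n ^ (m + 1) * (n * edim (blk p a z)) := by gcongr
        _ = _ := by ring

theorem exists_good_of_not_strongChain [WellFoundedLT ι] [CompleteSpace X] [CompleteSpace Y]
    [TopologicalSpace.SeparableSpace X] (hp : ProjNest p) (hq : ProjNest q)
    (hpq : ∀ i j, i ≤ j → 2 * edim (blk p i j) ≤ edim (blk q i j))
    (hne : ∀ i j, i < j → blk p i j ≠ ⊥) (hcov : ∀ i j, i ⋖ j → edim (blk p i j) ≠ ⊤)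
    (hsup : ∀ (k : ℕ → ι) (b : ι), Monotone k → (∀ j, k j ≤ b) → ∃ s, IsLUB (Set.range k) s ∧
      ∀ x, Filter.Tendsto (fun j => p (k j) x) Filter.atTop (nhds (p s x)))
    (hn : n ≠ 0) {A : Y →L[ℂ] X} (hA : Tri q p A) (L : ℕ) {ε : ℝ} (hε : 0 < ε) :
    ∃ κ ≥ 0, ∀ a b, a ≤ b → (∀ N ≤ b, ¬ StrongChain p n L a N) → Good p q A a b ε κ := by
  induction L generalizing ε with
  | zero =>
    refine ⟨0, le_rfl, fun a b hab h => ?_⟩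
    obtain rfl : a = b := le_antisymm hab (not_lt.1 (h b le_rfl))
    exact Good.self hε.le le_rfl
  | succ L ih =>
    obtain ⟨κ₀, hκ₀, h₀⟩ := ih (half_pos hε)
    obtain ⟨κ₁, hκ₁, h₁⟩ := exists_good_steps hp hq hpq hne hcov hn hA (half_pos hε) hκ₀
      (2 * n - 1)
    obtain ⟨κ₂, h₂⟩ := Good.of_monotone hp hq hpq hA (half_pos hε) hκ₁
    rw [mul_div_cancel₀ _ two_ne_zero] at h₂
    refine ⟨max κ₂ 0 + max κ₀ κ₁ + max κ₂ 0 * (‖A‖ + ε) * max κ₀ κ₁, by positivity,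
      fun a b hab h => ?_⟩
    have hshort : ∀ x w, a ≤ x → x ≤ w → w ≤ b → n * edim (blk p x w) ≤ edim (blk p a x) →
        Good p q A x w (ε / 2) κ₀ := fun x w hax hxw hwb hd => by
      rcases hax.eq_or_lt with rfl | hax
      · rw [blk_self, edim_eq_zero_iff.2 rfl, nonpos_iff_eq_zero, mul_eq_zero] at hd
        rcases hxw.eq_or_lt with rfl | hxw
        · exact Good.self (half_pos hε).le hκ₀
        · exact absurd (edim_eq_zero_iff.1 (hd.resolve_left (by exact_mod_cast hn)))
            (hne _ _ hxw)
      · refine h₀ x w hxw fun N hN hc => h N (hN.trans hwb) ⟨x, hax, le_trans ?_ hd, hc⟩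
        gcongr
        exact hp.edim_blk_mono le_rfl hc.lt.le hN
    have hstep : ∀ x : {x // a ≤ x ∧ x ≤ b ∧ edim (blk p a x) ≠ ⊤},
        ∃ y : {x // a ≤ x ∧ x ≤ b ∧ edim (blk p a x) ≠ ⊤}, x ≤ y ∧
          Good p q A x y (ε / 2) κ₁ ∧
          ((Good p q A x b (ε / 2) κ₁ ∧ x = y) ∨
            (x < y ∧ 2 * edim (blk p a x) ≤ edim (blk p x y))) := by
      rintro ⟨x, hax, hxb, hx⟩
      rcases h₁ a b hshort x hax hxb hx with hg | ⟨y, hxy, hyb, hy, hd, hg⟩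
      · exact ⟨⟨x, hax, hxb, hx⟩, le_rfl, Good.self (half_pos hε).le hκ₁, Or.inl ⟨hg, rfl⟩⟩
      · refine ⟨⟨y, hax.trans hxy.le, hyb, hy⟩, hxy.le, hg, Or.inr ⟨hxy, ?_⟩⟩
        have hadd := hp.edim_blk_add hax hxy.le
        have hy' := hy
        rw [← hadd] at hy' hd
        simp only [ne_eq, ENat.add_eq_top, not_or] at hy'
        obtain ⟨d, hd1⟩ := ENat.ne_top_iff_exists.1 hx
        obtain ⟨e, he1⟩ := ENat.ne_top_iff_exists.1 hy'.2
        have h3 := three_mul_pow_le hn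
        rw [show 2 * n - 1 + 1 = 2 * n by omega] at hd
        simp only at hd ⊢
        rw [← hd1, ← he1] at hd ⊢
        have hd2 : (n + 1) ^ (2 * n) * d ≤ n ^ (2 * n) * (d + e) := by exact_mod_cast hd
        have h4 : 0 < n ^ (2 * n) := by positivity
        have h5 : n ^ (2 * n) * (3 * d) ≤ n ^ (2 * n) * (d + e) := by
          refine le_trans ?_ hd2
          calc _ = 3 * n ^ (2 * n) * d := by ring
            _ ≤ _ := by gcongr
        have h6 := Nat.le_of_mul_le_mul_left h5 h4
        have h7 : 2 * d ≤ e := by omega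
        exact_mod_cast h7
    choose f hf1 hf2 hf3 using hstep
    let k : ℕ → {x // a ≤ x ∧ x ≤ b ∧ edim (blk p a x) ≠ ⊤} := fun j =>
      f^[j] ⟨a, le_rfl, hab, by simp [blk_self, edim_eq_zero_iff.2]⟩
    have hkf : ∀ j, k (j + 1) = f (k j) := fun j => Function.iterate_succ_apply' _ _ _
    have hmono : Monotone fun j => (k j : ι) := monotone_nat_of_le_succ fun j => by
      rw [hkf]; exact hf1 _
    obtain ⟨s, hs, hlim⟩ := hsup _ b hmono fun j => (k j).2.2.1
    have hks : ∀ j, (k j : ι) ≤ s := fun j => hs.1 ⟨j, rfl⟩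
    have hsb : s ≤ b := hs.2 (by rintro _ ⟨j, rfl⟩; exact (k j).2.2.1)
    have hG := h₂ (fun j => (k j : ι)) s hmono hks hlim
      (fun j => by simp only [hkf]; exact hf2 _) (fun j => (k j).2.2.2) (fun j => by
        rcases hf3 (k j) with h | h
        · left
          have h' : k (j + 1) = k j := (hkf j).trans h.2.symm
          rw [hkf (j + 1), h', ← hkf, h']
        · right
          rw [hkf]
          exact h.2)
    refine Good.trans hp hq hA (hks 0) hsb (hG.mono le_rfl (le_max_left _ _)) ?_
    by_cases hterm : ∃ j, Good p q A (k j) b (ε / 2) κ₁ ∧ k j = f (k j)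
    · obtain ⟨j, hj, hj'⟩ := hterm
      have hconst : ∀ i, (k i : ι) ≤ k j := fun i => by
        rcases le_total i j with hij | hij
        · exact hmono hij
        · obtain ⟨c, rfl⟩ := Nat.exists_eq_add_of_le hij
          refine le_of_eq ?_
          congr 1
          induction c with
          | zero => rfl
          | succ c ih => rw [← add_assoc, hkf, ih (by omega), ← hj']
      obtain rfl : s = k j := le_antisymm (hs.2 (by rintro _ ⟨i, rfl⟩; exact hconst i)) (hks j)
      exact hj.mono (by linarith) (le_max_right _ _)
    · have hstrict : StrictMono fun j => (k j : ι) := strictMono_nat_of_lt_succ fun j => by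
        rcases hf3 (k j) with h | h
        · exact absurd ⟨j, h⟩ hterm
        · rw [hkf]; exact h.1
      have htop : edim (blk p a s) = ⊤ := ENat.eq_top_iff_forall_ge.2 fun m =>
        (hp.le_edim_of_strictMono hne hstrict m).trans
          (hp.edim_blk_mono le_rfl (hmono m.zero_le) (hks m))
      exact (hshort s b (hks 0) hsb le_rfl (htop ▸ le_top)).mono (by linarith) (le_max_left _ _)

end Sufficient

section Sufficient

variable {ι X Y Z : Type*} [LinearOrder ι] [NormedAddCommGroup X] [InnerProductSpace ℂ X]
  [NormedAddCommGroup Y] [InnerProductSpace ℂ Y] [NormedAddCommGroup Z] [InnerProductSpace ℂ Z]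
  {p : ι → X →L[ℂ] X} {q : ι → Y →L[ℂ] Y} {r : ι → Z →L[ℂ] Z} {n : ℕ}

theorem RightDense.of_rightDense [BoundedOrder ι] [CompleteSpace X] [CompleteSpace Y]
    [CompleteSpace Z] [TopologicalSpace.SeparableSpace X] [TopologicalSpace.SeparableSpace Y]
    (hp : ProjNest p) (hq : ProjNest q) (hr : ProjNest r) (hd : RightDense p q) (hn : n ≠ 0)
    (hpq : ∀ i j, i ≤ j → edim (blk q i j) ≤ n * edim (blk p i j))
    (hpr : ∀ i j, i ≤ j → 2 * edim (blk p i j) ≤ edim (blk r i j))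
    (hne : ∀ i j, i < j → blk p i j ≠ ⊥)
    (hsup : ∀ (k : ℕ → ι) (b : ι), Monotone k → (∀ j, k j ≤ b) → ∃ s, IsLUB (Set.range k) s ∧
      ∀ x, Filter.Tendsto (fun j => p (k j) x) Filter.atTop (nhds (p s x)))
    (hbot : p ⊥ = 0) (htop : p ⊤ = ContinuousLinearMap.id ℂ X) : RightDense p r := by
  have := hd.wellFoundedLT hp hq hpq hne
  obtain ⟨L, hL⟩ := hd.exists_not_strongChain hp hq hpq hne ⊥ ⊤
  intro A hA ε hε
  obtain ⟨κ, -, h⟩ := exists_good_of_not_strongChain hp hr hpr hne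
    (fun i j hij => (edim_lt_top_iff.2 (hd.finiteDimensional_of_covBy hp hq hij)).ne) hsup hn hA L
    hε
  obtain ⟨Δ, C, hg, hΔ, -⟩ := h ⊥ ⊤ bot_le hL
  have hid : ∀ x, gap p ⊥ ⊤ x = x := fun x => by simp [gap_apply, hbot, htop]
  refine ⟨Δ, C, hg.tri_left, hg.tri_right, hΔ, fun x => ?_⟩
  have := hg.gap_apply x
  rwa [hid, hid] at this

end Sufficient

section Amplification

variable {H : Type*} [NormedAddCommGroup H] [InnerProductSpace ℂ H] {n : ℕ}

/-- The inclusion of `H` into `Hⁿ` as the `i`-th coordinate. -/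
noncomputable def incl (n : ℕ) (i : Fin n) : H →L[ℂ] PiLp 2 fun _ : Fin n => H :=
  (PiLp.continuousLinearEquiv 2 ℂ fun _ : Fin n => H).symm.toContinuousLinearMap ∘L
    ContinuousLinearMap.single ℂ (fun _ : Fin n => H) i

theorem incl_apply (i j : Fin n) (x : H) : incl n i x j = if j = i then x else 0 := by
  simp [incl]

theorem sum_incl_apply (y : PiLp 2 fun _ : Fin n => H) : ∑ i, incl n i (y i) = y := by
  ext j
  simp [incl_apply]

theorem norm_incl_apply (i : Fin n) (x : H) : ‖incl n i x‖ = ‖x‖ :=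
  PiLp.norm_single _ _ _ _

/-- The diagonal amplification of an operator to `Hⁿ`. -/
noncomputable def ampl (n : ℕ) (T : H →L[ℂ] H) :
    (PiLp 2 fun _ : Fin n => H) →L[ℂ] PiLp 2 fun _ : Fin n => H :=
  ∑ i, incl n i ∘L T ∘L PiLp.proj 2 (fun _ => H) i

theorem ampl_apply (T : H →L[ℂ] H) (y : PiLp 2 fun _ : Fin n => H) (j : Fin n) :
    ampl n T y j = T (y j) := by
  simp [ampl, incl_apply]

/-- The operator from `Hⁿ` to `H` given by a row of operators. -/
noncomputable def row (a : Fin n → H →L[ℂ] H) : (PiLp 2 fun _ : Fin n => H) →L[ℂ] H :=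
  ∑ i, a i ∘L PiLp.proj 2 (fun _ => H) i

theorem row_apply (a : Fin n → H →L[ℂ] H) (y : PiLp 2 fun _ : Fin n => H) :
    row a y = ∑ i, a i (y i) := by
  simp [row]

/-- The operator from `H` to `Hⁿ` given by a column of operators. -/
noncomputable def col (c : Fin n → H →L[ℂ] H) : H →L[ℂ] PiLp 2 fun _ : Fin n => H :=
  ∑ i, incl n i ∘L c i

theorem col_apply (c : Fin n → H →L[ℂ] H) (x : H) (j : Fin n) : col c x j = c j x := by
  simp [col, incl_apply]

theorem norm_row_le (a : Fin n → H →L[ℂ] H) : ‖row a‖ ≤ ∑ i, ‖a i‖ := by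
  refine ContinuousLinearMap.opNorm_le_bound _ (by positivity) fun y => ?_
  rw [row_apply, Finset.sum_mul]
  refine (norm_sum_le _ _).trans (Finset.sum_le_sum fun i _ => ?_)
  exact (a i).le_opNorm_of_le (PiLp.norm_apply_le y i)

theorem norm_comp_incl_le (B : (PiLp 2 fun _ : Fin n => H) →L[ℂ] H) (i : Fin n) :
    ‖B ∘L incl n i‖ ≤ ‖B‖ :=
  ContinuousLinearMap.opNorm_le_bound _ (norm_nonneg B) fun x => by
    rw [← norm_incl_apply i x]
    exact B.le_opNorm _

variable {ι : Type*} {p : ι → H →L[ℂ] H}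

theorem edim_blk_ampl (i j : ι) :
    edim (blk (fun k => ampl n (p k)) i j) = n * edim (blk p i j) := by
  have hmem : ∀ y : PiLp 2 fun _ : Fin n => H,
      y ∈ blk (fun k => ampl n (p k)) i j ↔ ∀ l, y l ∈ blk p i j := fun y => by
    simp only [mem_blk]
    rw [PiLp.ext_iff]
    simp only [gap_apply, PiLp.sub_apply, ampl_apply]
  let e : blk (fun k => ampl n (p k)) i j ≃ₗ[ℂ] (Fin n → blk p i j) :=
    { toFun := fun y l => ⟨y.1 l, (hmem _).1 y.2 l⟩
      invFun := fun f => ⟨WithLp.toLp 2 fun l => (f l : H), (hmem _).2 fun l => (f l).2⟩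
      map_add' := fun _ _ => rfl
      map_smul' := fun _ _ => rfl
      left_inv := fun _ => rfl
      right_inv := fun _ => rfl }
  rw [edim, edim, e.rank_eq, rank_fun_eq_lift_mul, map_mul]
  simp

theorem row_comp_incl (B : (PiLp 2 fun _ : Fin n => H) →L[ℂ] H) :
    row (fun i => B ∘L incl n i) = B := by
  ext y
  simp only [row_apply, ContinuousLinearMap.comp_apply]
  rw [← map_sum, sum_incl_apply]

theorem tri_row_iff {a : Fin n → H →L[ℂ] H} :
    Tri (fun k => ampl n (p k)) p (row a) ↔ ∀ i, Tri p p (a i) := by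
  constructor
  · intro h i k x
    have := h k (incl n i x)
    simpa [row_apply, ampl_apply, incl_apply, apply_ite, Finset.sum_ite_eq] using this
  · intro h k y
    simp only [row_apply, ampl_apply, map_sum, h _ k _]

theorem tri_col_iff {c : Fin n → H →L[ℂ] H} :
    Tri p (fun k => ampl n (p k)) (col c) ↔ ∀ i, Tri p p (c i) := by
  simp only [Tri, PiLp.ext_iff, ampl_apply, col_apply]
  exact ⟨fun h i k x => h k x i, fun h k x i => h i k x⟩

theorem ProjNest.ampl [LinearOrder ι] (hp : ProjNest p) : ProjNest fun k => ampl n (p k) where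
  inner_left k x y := by
    simp only [PiLp.inner_apply, ampl_apply, hp.inner_left]
  apply_of_ge h x := by
    ext l
    simp only [ampl_apply, hp.apply_of_ge h]

theorem rightDense_ampl_iff :
    RightDense p (fun k => _root_.ampl n (p k)) ↔ RgDenseIn {T | Tri p p T} n := by
  constructor
  · intro h a ha ε hε
    obtain ⟨B, C, hB, hC, hBn, hBC⟩ := h (row a) (tri_row_iff.2 ha) (ε / 2) (half_pos hε)
    rw [← row_comp_incl B] at hB hBC
    refine ⟨fun i => a i + B ∘L incl n i, fun i => PiLp.proj 2 (fun _ => H) i ∘L C,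
      fun i => (ha i).add (tri_row_iff.1 hB i), tri_col_iff.1 ?_, fun i => ?_, ?_⟩
    · convert hC using 1
      ext x i
      simp [col_apply]
    · rw [sub_add_cancel_left, norm_neg]
      linarith [norm_comp_incl_le B i]
    · ext x
      refine Eq.trans ?_ (hBC x)
      rw [row_apply, row_apply, ← Finset.sum_add_distrib]
      simp
  · intro h A hA ε hε
    rw [← row_comp_incl A] at hA
    obtain ⟨b, c, hb, hc, hbn, hbc⟩ := h _ (tri_row_iff.1 hA) (ε / (n + 1)) (by positivity)
    refine ⟨row fun i => b i - A ∘L incl n i, col c,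
      tri_row_iff.2 fun i => (hb i).sub (tri_row_iff.1 hA i), tri_col_iff.2 hc, ?_, fun x => ?_⟩
    · refine (norm_row_le _).trans ?_
      refine (Finset.sum_le_card_nsmul _ _ _ fun i _ => by
        rw [norm_sub_rev]; exact (hbn i).le).trans ?_
      rw [Finset.card_univ, Fintype.card_fin, nsmul_eq_mul, mul_div_assoc',
        div_le_iff₀ (by positivity)]
      nlinarith
    · nth_rewrite 1 [← row_comp_incl A]
      have := congrArg (fun T : H →L[ℂ] H => T x) hbc
      rw [row_apply, row_apply, ← Finset.sum_add_distrib]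
      simp only [col_apply]
      simpa using this

end Amplification

section Nest

variable {H : Type*} [NormedAddCommGroup H] [InnerProductSpace ℂ H]
  {𝒩 : Set (Submodule ℂ H)} {n : ℕ}

/-- The elements of a nest, as a linear order. -/
def NestIdx (_ : IsNest 𝒩) : Type _ := 𝒩

noncomputable instance (h : IsNest 𝒩) : LinearOrder (NestIdx h) :=
  open Classical in h.chain.linearOrder

instance (h : IsNest 𝒩) : BoundedOrder (NestIdx h) where
  top := ⟨⊤, h.top_mem⟩
  le_top _ := le_top (α := Submodule ℂ H)
  bot := ⟨⊥, h.bot_mem⟩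
  bot_le _ := bot_le (α := Submodule ℂ H)

namespace IsNest

theorem exists_covBy_or_le_closure (h : IsNest 𝒩) (N : NestIdx h) :
    (∃ M, M ⋖ N) ∨ N.1 ≤ (sSup {M ∈ 𝒩 | M < N.1}).topologicalClosure := by
  refine or_iff_not_imp_right.2 fun hN => ?_
  have hlt : ∀ M ∈ 𝒩, M < N.1 → M ≤ (sSup {M ∈ 𝒩 | M < N.1}).topologicalClosure :=
    fun M hM hMN => (le_sSup (show M ∈ {M ∈ 𝒩 | M < N.1} from ⟨hM, hMN⟩)).trans (Submodule.le_topologicalClosure _)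
  have hne : {M ∈ 𝒩 | M < N.1}.Nonempty := by
    refine ⟨⊥, h.bot_mem, bot_lt_iff_ne_bot.2 fun h0 => hN ?_⟩
    rw [h0]
    exact bot_le
  let M : NestIdx h := ⟨_, h.closure_sSup_mem {M ∈ 𝒩 | M < N.1} (fun _ hM => hM.1) hne⟩
  have hMN : ¬ N ≤ M := hN
  exact ⟨M, not_le.1 hMN, fun K h1 h2 => absurd h1 (not_lt.2 (hlt K.1 K.2 h2))⟩

variable [CompleteSpace H]

theorem hasOrthogonalProjection (h : IsNest 𝒩) (N : NestIdx h) :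
    N.1.HasOrthogonalProjection :=
  have := (h.closed N.1 N.2).completeSpace_coe
  inferInstance

/-- The orthogonal projections onto the elements of a nest. -/
noncomputable def proj (h : IsNest 𝒩) (N : NestIdx h) : H →L[ℂ] H :=
  have := h.hasOrthogonalProjection N
  N.1.starProjection

theorem proj_eq_self_iff (h : IsNest 𝒩) {N : NestIdx h} {x : H} : h.proj N x = x ↔ x ∈ N.1 :=
  have := h.hasOrthogonalProjection N
  N.1.starProjection_eq_self_iff

theorem proj_mem (h : IsNest 𝒩) (N : NestIdx h) (x : H) : h.proj N x ∈ N.1 :=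
  have := h.hasOrthogonalProjection N
  N.1.starProjection_apply_mem x

theorem projNest (h : IsNest 𝒩) : ProjNest h.proj where
  inner_left N x y :=
    have := h.hasOrthogonalProjection N
    N.1.inner_starProjection_left_eq_right x y
  apply_of_ge {M _} hMN x := h.proj_eq_self_iff.2 (hMN (h.proj_mem M x))

theorem nestAlg_eq (h : IsNest 𝒩) : nestAlg 𝒩 = {T | Tri h.proj h.proj T} := by
  ext T
  refine ⟨fun hT N x => h.proj_eq_self_iff.2 (hT N.1 N.2 _ (h.proj_mem N x)),
    fun hT N hN x hx => ?_⟩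
  let K : NestIdx h := ⟨N, hN⟩
  have hx' : h.proj K x = x := h.proj_eq_self_iff.2 hx
  exact h.proj_eq_self_iff.1 (hT.apply_eq hx')

theorem blk_ne_bot (h : IsNest 𝒩) {M N : NestIdx h} (hMN : M < N) : blk h.proj M N ≠ ⊥ := by
  refine fun h0 => not_le.2 hMN fun x hx => ?_
  have h1 := h.projNest.gap_mem_blk hMN.le x
  rw [h0, Submodule.mem_bot, gap_apply, h.proj_eq_self_iff.2 hx, sub_eq_zero] at h1
  rw [h1]
  exact h.proj_mem M x

theorem proj_bot (h : IsNest 𝒩) : h.proj ⊥ = 0 := by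
  ext x
  exact (Submodule.mem_bot ℂ).1 (h.proj_mem ⊥ x)

theorem proj_top (h : IsNest 𝒩) : h.proj ⊤ = ContinuousLinearMap.id ℂ H := by
  ext x
  exact h.proj_eq_self_iff.2 (Submodule.mem_top (x := x))

theorem exists_isLUB (h : IsNest 𝒩) (k : ℕ → NestIdx h) (hk : Monotone k) :
    ∃ s, IsLUB (Set.range k) s ∧
      ∀ x, Filter.Tendsto (fun j => h.proj (k j) x) Filter.atTop (nhds (h.proj s x)) := by
  have hmem := h.closure_sSup_mem (Set.range fun j => (k j).1)
    (by rintro _ ⟨j, rfl⟩; exact (k j).2) (Set.range_nonempty _)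
  rw [sSup_range] at hmem
  refine ⟨⟨_, hmem⟩, ⟨?_, fun N hN => ?_⟩, fun x => ?_⟩
  · rintro _ ⟨j, rfl⟩
    exact (le_iSup (fun j => (k j).1) j).trans (Submodule.le_topologicalClosure _)
  · exact Submodule.topologicalClosure_minimal _ (iSup_le fun j => hN ⟨j, rfl⟩) (h.closed _ N.2)
  · have := fun j => h.hasOrthogonalProjection (k j)
    have : (⨆ j, (k j).1).topologicalClosure.HasOrthogonalProjection :=
      h.hasOrthogonalProjection ⟨_, hmem⟩
    exact Submodule.starProjection_tendsto_closure_iSup (fun j => (k j).1) hk x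

theorem rightDense_iff (h : IsNest 𝒩) :
    RightDense h.proj (fun N => ampl n (h.proj N)) ↔ RgDenseIn (nestAlg 𝒩) n := by
  rw [rightDense_ampl_iff, nestAlg_eq h]

theorem finiteDimensional (h : IsNest 𝒩) [WellFoundedLT (NestIdx h)] [WellFoundedGT (NestIdx h)]
    (hcov : ∀ M N : NestIdx h, M ⋖ N → FiniteDimensional ℂ (blk h.proj M N)) :
    FiniteDimensional ℂ H := by
  have key : ∀ N : NestIdx h, edim (blk h.proj ⊥ N) < ⊤ := fun N => by
    induction N using WellFoundedLT.induction with
    | ind N ih =>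
      rcases eq_or_ne N ⊥ with rfl | hN
      · rw [blk_self, edim_eq_zero_iff.2 rfl]
        exact WithTop.top_pos
      · obtain ⟨M, hM, hmin⟩ := WellFounded.has_min (wellFounded_gt (α := NestIdx h)) (Set.Iio N)
          ⟨⊥, bot_lt_iff_ne_bot.2 hN⟩
        rw [← h.projNest.edim_blk_add bot_le (le_of_lt hM)]
        refine WithTop.add_lt_top.2 ⟨ih M hM, edim_lt_top_iff.2 (hcov M N ⟨hM, fun K h1 h2 => ?_⟩)⟩
        exact hmin K h2 h1
  have h1 := edim_lt_top_iff.1 (key ⊤)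
  have h2 : blk h.proj ⊥ ⊤ = ⊤ := by
    refine eq_top_iff.2 fun x _ => mem_blk.2 ?_
    rw [gap_apply, h.proj_bot, h.proj_top]
    simp
  rw [h2] at h1
  exact Module.Finite.equiv (Submodule.topEquiv (R := ℂ) (M := H))

variable [TopologicalSpace.SeparableSpace H]

theorem rgDenseIn_two (h : IsNest 𝒩) (hn : n ≠ 0) (hd : RgDenseIn (nestAlg 𝒩) n) :
    RgDenseIn (nestAlg 𝒩) 2 :=
  h.rightDense_iff.1 (RightDense.of_rightDense h.projNest h.projNest.ampl h.projNest.ampl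
    (h.rightDense_iff.2 hd) hn (fun _ _ _ => (edim_blk_ampl _ _).le)
    (fun _ _ _ => (edim_blk_ampl _ _).ge) (fun _ _ => h.blk_ne_bot)
    (fun k _ hk _ => h.exists_isLUB k hk) h.proj_bot h.proj_top)

theorem wellFoundedLT (h : IsNest 𝒩) (hd : RgDenseIn (nestAlg 𝒩) n) :
    WellFoundedLT (NestIdx h) :=
  (h.rightDense_iff.2 hd).wellFoundedLT h.projNest h.projNest.ampl
    (fun _ _ _ => (edim_blk_ampl _ _).le) fun _ _ => h.blk_ne_bot

theorem finiteDimensional_of_covBy (h : IsNest 𝒩) (hd : RgDenseIn (nestAlg 𝒩) n)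
    {M N : NestIdx h} (hMN : M ⋖ N) : FiniteDimensional ℂ (blk h.proj M N) :=
  (h.rightDense_iff.2 hd).finiteDimensional_of_covBy h.projNest h.projNest.ampl hMN

end IsNest

end Nest

section Inverse

variable {H : Type*} [NormedAddCommGroup H] [InnerProductSpace ℂ H]
  {𝒩 : Set (Submodule ℂ H)}

theorem gap_comp_eq_of_finiteDimensional {ι : Type*} [LinearOrder ι] {p : ι → H →L[ℂ] H}
    (hp : ProjNest p) {i j : ι} (hij : i ≤ j) [FiniteDimensional ℂ (blk p i j)]
    {B C : H →L[ℂ] H} (hB : Tri p p B) (hC : Tri p p C) (hBC : ∀ x, B (C x) = x) {x : H}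
    (hx : x ∈ blk p i j) : gap p i j (C (B x)) = x := by
  let β : blk p i j →ₗ[ℂ] blk p i j :=
    ((gap p i j ∘L B : H →L[ℂ] H) : H →ₗ[ℂ] H).restrict fun x _ => hp.gap_mem_blk hij (B x)
  let γ : blk p i j →ₗ[ℂ] blk p i j :=
    ((gap p i j ∘L C : H →L[ℂ] H) : H →ₗ[ℂ] H).restrict fun x _ => hp.gap_mem_blk hij (C x)
  have hβγ : β * γ = 1 := by
    ext v
    have hv := mem_blk.1 v.2
    change gap p i j (B (gap p i j (C v))) = v
    rw [← hv, hB.gap_comp hp hp hC hij, hBC, hv, hv]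
  have h1 := congrArg (fun f => ((f ⟨x, hx⟩ : blk p i j) : H)) (mul_eq_one_comm.1 hβγ)
  change gap p i j (C (gap p i j (B x))) = x at h1
  rw [← mem_blk.1 hx, hC.gap_comp hp hp hB hij, mem_blk.1 hx] at h1
  exact h1

variable [CompleteSpace H]

/-- In a well-ordered nest with finite-dimensional atoms right inverses are two-sided. -/
theorem IsNest.comp_eq_of_comp_eq (h : IsNest 𝒩) [WellFoundedLT (NestIdx h)]
    (hcov : ∀ M N : NestIdx h, M ⋖ N → FiniteDimensional ℂ (blk h.proj M N))
    {B C : H →L[ℂ] H} (hB : B ∈ nestAlg 𝒩) (hC : C ∈ nestAlg 𝒩) (hBC : B * C = 1) :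
    C * B = 1 := by
  have hBC' : ∀ x, B (C x) = x := fun x => congrArg (fun T : H →L[ℂ] H => T x) hBC
  have hB' : Tri h.proj h.proj B := by rwa [h.nestAlg_eq] at hB
  have hC' : Tri h.proj h.proj C := by rwa [h.nestAlg_eq] at hC
  have key : ∀ N : NestIdx h, N.1 ≤ (C * B - 1 : H →L[ℂ] H).ker := fun N => by
    induction N using WellFoundedLT.induction with
    | ind N ih =>
      rcases h.exists_covBy_or_le_closure N with ⟨M, hMN⟩ | hN
      · intro x hx
        have := hcov M N hMN
        have hxN := h.proj_eq_self_iff.2 hx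
        have hx1 : h.proj M x + gap h.proj M N x = x := by
          rw [gap_apply, add_sub_cancel, hxN]
        have h1 : gap h.proj M N (C (B x)) = gap h.proj M N x := by
          nth_rewrite 1 [← hx1]
          rw [map_add, map_add, map_add, gap_comp_eq_of_finiteDimensional h.projNest hMN.le hB' hC'
            hBC' (h.projNest.gap_mem_blk hMN.le x)]
          have h2 := (hC'.comp hB').gap_apply_eq_zero h.projNest hMN.le le_rfl x
          rw [ContinuousLinearMap.comp_apply] at h2
          rw [h2, zero_add]
        have hy : C (B x) - x ∈ M.1 := by
          have h2 : h.proj N (C (B x)) = C (B x) := hC'.apply_eq (hB'.apply_eq hxN)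
          rw [gap_apply, gap_apply, h2, hxN] at h1
          have h3 : C (B x) - x = h.proj M (C (B x) - x) := by
            rw [map_sub, sub_eq_sub_iff_sub_eq_sub]
            exact h1
          rw [h3]
          exact h.proj_mem M _
        have h4 : C (B (C (B x) - x)) - (C (B x) - x) = 0 := ih M hMN.lt hy
        rw [map_sub, hBC', sub_self, map_zero, zero_sub, neg_eq_zero] at h4
        exact h4
      · exact hN.trans (Submodule.topologicalClosure_minimal _
          (sSup_le fun M hM => ih ⟨M, hM.1⟩ hM.2) (ContinuousLinearMap.isClosed_ker _))
  ext x
  exact sub_eq_zero.1 (key ⊤ (Submodule.mem_top (x := x)))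

theorem IsNest.lgDenseIn_one [TopologicalSpace.SeparableSpace H] (h : IsNest 𝒩)
    (hd : RgDenseIn (nestAlg 𝒩) 1) : LgDenseIn (nestAlg 𝒩) 1 := by
  intro a ha ε hε
  obtain ⟨b, c, hb, hc, hab, hbc⟩ := hd a ha ε hε
  have := h.wellFoundedLT hd
  rw [Fin.sum_univ_one] at hbc
  refine ⟨b, c, hb, hc, hab, ?_⟩
  rw [Fin.sum_univ_one]
  exact h.comp_eq_of_comp_eq (fun _ _ => h.finiteDimensional_of_covBy hd) (hb 0) (hc 0) hbc

end Inverse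

section Adjoint

theorem RgDenseIn.star {A : Type*} [NormedRing A] [StarRing A] [NormedStarGroup A] {S T : Set A}
    {n : ℕ} (hST : ∀ a, a ∈ T ↔ star a ∈ S) (h : RgDenseIn S n) : LgDenseIn T n := by
  intro a ha ε hε
  obtain ⟨b, c, hb, hc, hab, hbc⟩ := h (fun i => Star.star (a i)) (fun i => (hST _).1 (ha i)) ε hε
  refine ⟨fun i => Star.star (b i), fun i => Star.star (c i), fun i => (hST _).2 ?_,
    fun i => (hST _).2 ?_, fun i => ?_, ?_⟩
  · rw [star_star]
    exact hb i
  · rw [star_star]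
    exact hc i
  · rw [← norm_star, star_sub, star_star]
    exact hab i
  · simpa using congrArg Star.star hbc

theorem LgDenseIn.star {A : Type*} [NormedRing A] [StarRing A] [NormedStarGroup A] {S T : Set A}
    {n : ℕ} (hST : ∀ a, a ∈ T ↔ star a ∈ S) (h : LgDenseIn S n) : RgDenseIn T n := by
  intro a ha ε hε
  obtain ⟨b, c, hb, hc, hab, hbc⟩ := h (fun i => Star.star (a i)) (fun i => (hST _).1 (ha i)) ε hε
  refine ⟨fun i => Star.star (b i), fun i => Star.star (c i), fun i => (hST _).2 ?_,
    fun i => (hST _).2 ?_, fun i => ?_, ?_⟩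
  · rw [star_star]
    exact hb i
  · rw [star_star]
    exact hc i
  · rw [← norm_star, star_sub, star_star]
    exact hab i
  · simpa using congrArg Star.star hbc

variable {H : Type*} [NormedAddCommGroup H] [InnerProductSpace ℂ H] [CompleteSpace H]
  {𝒩 : Set (Submodule ℂ H)}

namespace IsNest

theorem orthogonal_orthogonal (h : IsNest 𝒩) {N : Submodule ℂ H} (hN : N ∈ 𝒩) : Nᗮᗮ = N :=
  have := h.hasOrthogonalProjection ⟨N, hN⟩
  Submodule.orthogonal_orthogonal N

/-- The nest of orthogonal complements. -/
theorem orthogonal (h : IsNest 𝒩) : IsNest ((fun N : Submodule ℂ H => Nᗮ) '' 𝒩) where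
  closed := by
    rintro _ ⟨N, -, rfl⟩
    exact N.isClosed_orthogonal
  chain := by
    rintro _ ⟨M, hM, rfl⟩ _ ⟨N, hN, rfl⟩ -
    exact (h.chain.total hN hM).imp Submodule.orthogonal_le Submodule.orthogonal_le
  bot_mem := ⟨⊤, h.top_mem, Submodule.top_orthogonal_eq_bot⟩
  top_mem := ⟨⊥, h.bot_mem, Submodule.bot_orthogonal_eq_top⟩
  sInf_mem := by
    intro S hS hne
    obtain ⟨U, hU, rfl⟩ := Set.subset_image_iff.1 hS
    refine ⟨_, h.closure_sSup_mem U hU hne.of_image, ?_⟩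
    change (sSup U).topologicalClosureᗮ = _
    rw [Submodule.orthogonal_closure, ← Submodule.sInf_orthogonal, sInf_image]
  closure_sSup_mem := by
    intro S hS hne
    obtain ⟨U, hU, rfl⟩ := Set.subset_image_iff.1 hS
    refine ⟨_, h.sInf_mem U hU hne.of_image, ?_⟩
    change (sInf U)ᗮ = _
    rw [← Submodule.orthogonal_orthogonal_eq_closure, ← Submodule.sInf_orthogonal, iInf_image,
      sInf_eq_iInf]
    exact congrArg _ (biInf_congr fun N hN => (h.orthogonal_orthogonal (hU hN)).symm)

theorem mem_nestAlg_orthogonal_iff (h : IsNest 𝒩) (T : H →L[ℂ] H) :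
    T ∈ nestAlg ((fun N : Submodule ℂ H => Nᗮ) '' 𝒩) ↔ star T ∈ nestAlg 𝒩 := by
  constructor
  · intro hT N hN x hx
    rw [← h.orthogonal_orthogonal hN, Submodule.mem_orthogonal]
    intro y hy
    rw [ContinuousLinearMap.star_eq_adjoint, ContinuousLinearMap.adjoint_inner_right]
    exact Submodule.inner_left_of_mem_orthogonal hx (hT _ ⟨N, hN, rfl⟩ y hy)
  · rintro hT _ ⟨N, hN, rfl⟩ x hx
    rw [Submodule.mem_orthogonal]
    intro y hy
    rw [← ContinuousLinearMap.adjoint_inner_left, ← ContinuousLinearMap.star_eq_adjoint]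
    exact Submodule.inner_right_of_mem_orthogonal (hT N hN y hy) hx

theorem lgDenseIn_iff (h : IsNest 𝒩) {n : ℕ} :
    LgDenseIn (nestAlg 𝒩) n ↔ RgDenseIn (nestAlg ((fun N : Submodule ℂ H => Nᗮ) '' 𝒩)) n := by
  refine ⟨fun hd => hd.star h.mem_nestAlg_orthogonal_iff, fun hd => hd.star fun T => ?_⟩
  rw [h.mem_nestAlg_orthogonal_iff, star_star]

theorem wellFoundedGT_of_orthogonal (h : IsNest 𝒩) [WellFoundedLT (NestIdx h.orthogonal)] :
    WellFoundedGT (NestIdx h) :=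
  let f : NestIdx h → NestIdx h.orthogonal := fun N => ⟨N.1ᗮ, N.1, N.2, rfl⟩
  have hf : StrictAnti f := fun M N hMN => lt_of_not_ge fun hle => not_le.2 hMN <| by
    have := Submodule.orthogonal_le (show M.1ᗮ ≤ N.1ᗮ from hle)
    rwa [h.orthogonal_orthogonal M.2, h.orthogonal_orthogonal N.2] at this
  hf.wellFoundedGT

end IsNest

end Adjoint

theorem IsNest.finiteDimensional_of_rgDenseIn_of_lgDenseIn {H : Type*} [NormedAddCommGroup H]
    [InnerProductSpace ℂ H] [CompleteSpace H] [TopologicalSpace.SeparableSpace H]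
    {𝒩 : Set (Submodule ℂ H)} (h : IsNest 𝒩) {n m : ℕ} (hr : RgDenseIn (nestAlg 𝒩) n)
    (hl : LgDenseIn (nestAlg 𝒩) m) : FiniteDimensional ℂ H := by
  have := h.wellFoundedLT hr
  have := h.orthogonal.wellFoundedLT (h.lgDenseIn_iff.1 hl)
  have := h.wellFoundedGT_of_orthogonal
  exact h.finiteDimensional fun _ _ => h.finiteDimensional_of_covBy hr

/-- **Corollary.**  For any nest `𝒩` on an infinite-dimensional separable
complex Hilbert space: (a) `rtsr(T(𝒩)) ∈ {2, ∞}`; (b) `ltsr(T(𝒩)) ∈ {2, ∞}`;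
(c) `max{rtsr(T(𝒩)), ltsr(T(𝒩))} = ∞`. -/
theorem rtsr_ltsr_nestAlgebra_two_or_infty
    {H : Type*} [NormedAddCommGroup H] [InnerProductSpace ℂ H]
    [CompleteSpace H] [TopologicalSpace.SeparableSpace H]
    (hinf : ¬ FiniteDimensional ℂ H)
    {𝒩 : Set (Submodule ℂ H)} (h𝒩 : IsNest 𝒩) :
    ((∃ n : ℕ, 1 ≤ n ∧ RgDenseIn (nestAlg 𝒩) n) →
        (RgDenseIn (nestAlg 𝒩) 2 ∧ ¬ RgDenseIn (nestAlg 𝒩) 1)) ∧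
    ((∃ n : ℕ, 1 ≤ n ∧ LgDenseIn (nestAlg 𝒩) n) →
        (LgDenseIn (nestAlg 𝒩) 2 ∧ ¬ LgDenseIn (nestAlg 𝒩) 1)) ∧
    ¬ ((∃ n : ℕ, 1 ≤ n ∧ RgDenseIn (nestAlg 𝒩) n) ∧
       (∃ m : ℕ, 1 ≤ m ∧ LgDenseIn (nestAlg 𝒩) m)) := by
  have key : ∀ {ℳ : Set (Submodule ℂ H)}, IsNest ℳ → (∃ n : ℕ, 1 ≤ n ∧ RgDenseIn (nestAlg ℳ) n) →
      RgDenseIn (nestAlg ℳ) 2 ∧ ¬ RgDenseIn (nestAlg ℳ) 1 := by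
    rintro ℳ h ⟨n, hn, hd⟩
    exact ⟨h.rgDenseIn_two (Nat.one_le_iff_ne_zero.1 hn) hd, fun h1 =>
      hinf (h.finiteDimensional_of_rgDenseIn_of_lgDenseIn h1 (h.lgDenseIn_one h1))⟩
  refine ⟨key h𝒩, ?_, fun ⟨⟨n, _, hr⟩, m, _, hl⟩ =>
    hinf (h𝒩.finiteDimensional_of_rgDenseIn_of_lgDenseIn hr hl)⟩
  simp only [h𝒩.lgDenseIn_iff]
  exact key h𝒩.orthogonal
end

section
/- Let A be a unital complex Banach algebra containing a set of n×n partial matrix units P_1,…,P_n, U_2,…,U_n, V_2,…,V_n, and let A_1 = P_1 A P_1 = {a ∈ A : P_1 a P_1 = a}, a closed subalgebra of A which is a unital Banach algebra with unit P_1. Then for every p ≥ 1, if Rg_p(A) is dense in A^p, then Rg_{(p−1)n+1}(A_1) is dense in A_1^{(p−1)n+1}; consequently rtsr(A_1) ≤ (rtsr(A) − 1)n + 1, and hence ⌈(rtsr(A_1) − 1)/n⌉ + 1 ≤ rtsr(A). -/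
/-- The element `0` of `Fin n` when `1 ≤ n`. -/
def fin0 {n : ℕ} (hn : 1 ≤ n) : Fin n := ⟨0, Nat.lt_of_lt_of_le Nat.zero_lt_one hn⟩

/-- `RgDenseInUnit S e p` says: the `p`-tuples from `S ⊆ A` admitting a tuple
from `S` with `∑ b_i c_i = e` (where `e` is the unit of the subalgebra `S`)
are dense among all `p`-tuples from `S`. -/
def RgDenseInUnit {A : Type*} [NormedRing A] (S : Set A) (e : A) (p : ℕ) : Prop :=
  ∀ a : Fin p → A, (∀ i, a i ∈ S) → ∀ ε : ℝ, 0 < ε →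
    ∃ b c : Fin p → A, (∀ i, b i ∈ S) ∧ (∀ i, c i ∈ S) ∧
      (∀ i, ‖a i - b i‖ < ε) ∧ ∑ i, b i * c i = e

open Topology in
/-- Completing the upper left corner: if `y` is close to `x` with `P x (1 - P) = 0` and
`(1 - P) x (1 - P) = 1 - P`, then a small `t ∈ P A (1 - P)` satisfies `(P - t) y (1 - P) = 0`. -/
theorem exists_continuousAt_schur_complement {A : Type*} [NormedRing A] [CompleteSpace A]
    {P x : A} (hP : P * P = P) (hx : P * x * (1 - P) = 0)
    (hx' : (1 - P) * x * (1 - P) = 1 - P) :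
    ∃ t : A → A, t x = 0 ∧ ContinuousAt t x ∧
      ∀ᶠ y in 𝓝 x, P * t y = t y ∧ t y * P = 0 ∧ (P - t y) * y * P = (P - t y) * y := by
  have hD : ContinuousAt (fun y : A => P + (1 - P) * y * (1 - P)) x := by fun_prop
  have hDx : P + (1 - P) * x * (1 - P) = ((1 : Aˣ) : A) := by rw [hx']; simp
  refine ⟨fun y => P * y * (1 - P) * Ring.inverse (P + (1 - P) * y * (1 - P)), ?_, ?_, ?_⟩
  · simp only [hx, zero_mul]
  · have hinv : ContinuousAt (fun y : A => Ring.inverse (P + (1 - P) * y * (1 - P))) x := by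
      refine ContinuousAt.comp (g := Ring.inverse) (f := fun y : A => P + (1 - P) * y * (1 - P))
        ?_ hD
      rw [hDx]
      exact NormedRing.inverse_continuousAt 1
    have hy : ContinuousAt (fun y : A => P * y * (1 - P)) x := by fun_prop
    exact hy.mul hinv
  · have hunit : ∀ᶠ y in 𝓝 x, IsUnit (P + (1 - P) * y * (1 - P)) := by
      refine hD.eventually (p := fun z => IsUnit z) ?_
      simp only [hDx]
      exact Units.nhds 1
    filter_upwards [hunit] with y hy
    have hEP : (1 - P) * P = 0 := by rw [sub_mul, hP, one_mul, sub_self]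
    have hPE : P * (1 - P) = 0 := by rw [mul_sub, hP, mul_one, sub_self]
    have hEE : (1 - P) * (1 - P) = 1 - P := by rw [mul_sub, hEP, mul_one, sub_zero]
    set E := 1 - P with hE
    set D := P + E * y * E with hDdef
    set r := Ring.inverse D
    have hDr : D * r = 1 := Ring.mul_inverse_cancel _ hy
    have hrD : r * D = 1 := Ring.inverse_mul_cancel _ hy
    have hDP : D * P = P := by rw [hDdef, add_mul, hP, mul_assoc, hEP, mul_zero, add_zero]
    have hPD : P * D = P := by
      rw [hDdef, mul_add, hP, mul_assoc, ← mul_assoc P, hPE, zero_mul, add_zero]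
    have hrP : r * P = P := by
      calc r * P = r * (D * P) := by rw [hDP]
        _ = P := by rw [← mul_assoc, hrD, one_mul]
    have hPr : P * r = P := by
      calc P * r = P * D * r := by rw [hPD]
        _ = P := by rw [mul_assoc, hDr, mul_one]
    have hrE : r * E = E * r := by rw [hE, mul_sub, sub_mul, hrP, hPr, mul_one, one_mul]
    have hDE : D * E = E * y * E := by
      rw [hDdef, add_mul, hPE, zero_add, mul_assoc, hEE]
    have hErE : E * r * E = E * r := by rw [mul_assoc, hrE, ← mul_assoc, hEE]
    have htyE : P * y * E * r * y * E = P * y * E := by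
      calc P * y * E * r * y * E = P * y * (E * r) * y * E := by simp only [mul_assoc]
        _ = P * y * (E * r * E) * y * E := by rw [hErE]
        _ = P * y * E * r * (E * y * E) := by simp only [mul_assoc]
        _ = P * y * E * (r * D) * E := by rw [← hDE]; simp only [mul_assoc]
        _ = P * y * E := by rw [hrD, mul_one, mul_assoc, hEE]
    refine ⟨?_, ?_, ?_⟩
    · simp only [← mul_assoc, hP]
    · rw [mul_assoc, hrP, mul_assoc, hEP, mul_zero]
    · have h0 : (P - P * y * E * r) * y * E = 0 := by
        rw [sub_mul, sub_mul, htyE, sub_self]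
      rw [hE, mul_sub, mul_one, sub_eq_zero] at h0
      exact h0.symm

/-- Density of right unimodular rows passes from `A` to the corner `P A P` when
`1 = ∑ j, U j * V j` factors through `P`. -/
theorem RgDenseInUnit.corner {A : Type*} [NormedRing A] [CompleteSpace A] {n q : ℕ} {P : A}
    {U V : Fin n → A} (hP : P * P = P) (hU : ∀ j, U j * P = U j) (hV : ∀ j, P * V j = V j)
    (hUV : ∑ j, U j * V j = 1) (hA : RgDenseInUnit (Set.univ : Set A) 1 (q + 1)) :
    RgDenseInUnit {a : A | P * a * P = a} P (q * n + 1) := by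
  intro a ha ε hε
  have hPa (i) : P * a i = a i := by rw [← ha i, ← mul_assoc, ← mul_assoc, hP]
  have haP (i) : a i * P = a i := by rw [← ha i, mul_assoc, hP]
  let x : Fin (q + 1) → A := Fin.cons (a 0 + (1 - P))
    fun k => ∑ j, a (finProdFinEquiv (k, j)).succ * V j
  have hPx (k : Fin q) : P * x k.succ = x k.succ := by
    simp [x, Finset.mul_sum, ← mul_assoc, hPa]
  obtain ⟨t, htx, htc, ht⟩ := exists_continuousAt_schur_complement (P := P) (x := x 0) hP
    (by simp [x, mul_add, mul_sub, hP, hPa, haP])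
    (by simp [x, mul_add, mul_sub, sub_mul, hP, hPa])
  have h0 : Filter.Tendsto (fun y : Fin (q + 1) → A => y 0) (nhds x) (nhds (x 0)) :=
    (continuous_apply 0).continuousAt
  have htc' : ContinuousAt (fun y : Fin (q + 1) → A => t (y 0)) x :=
    ContinuousAt.comp (g := t) (f := fun y : Fin (q + 1) → A => y 0) htc h0
  have hz (k : Fin (q + 1)) : ContinuousAt (fun y : Fin (q + 1) → A => (P - t (y 0)) * y k) x :=
    (continuousAt_const.sub htc').mul (continuous_apply k).continuousAt
  have hclose₀ : ∀ᶠ y in nhds x, ‖a 0 - (P - t (y 0)) * y 0 * P‖ < ε := by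
    have hc : ContinuousAt (fun y : Fin (q + 1) → A => ‖a 0 - (P - t (y 0)) * y 0 * P‖) x := by
      have := hz 0
      fun_prop
    refine hc.eventually_lt continuousAt_const ?_
    simp only [htx, sub_zero]
    simpa [x, mul_add, mul_sub, hP, hPa, haP] using hε
  have hclose : ∀ᶠ y in nhds x, ∀ (k : Fin q) (j : Fin n),
      ‖((P - t (y 0)) * y k.succ - x k.succ) * U j‖ < ε := by
    simp only [Filter.eventually_all]
    intro k j
    have hc : ContinuousAt (fun y : Fin (q + 1) → A =>
        ‖((P - t (y 0)) * y k.succ - x k.succ) * U j‖) x := by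
      have := hz k.succ
      fun_prop
    refine hc.eventually_lt continuousAt_const ?_
    simpa [htx, hPx] using hε
  obtain ⟨δ, hδ, hball⟩ := Metric.eventually_nhds_iff.1
    ((h0.eventually ht).and (hclose₀.and hclose))
  obtain ⟨y, c, -, -, hy, hyc⟩ := hA x (fun _ => Set.mem_univ _) δ hδ
  obtain ⟨⟨hPt, htP, hzP⟩, hy₀, hys⟩ := hball (y := y) <| by
    rw [dist_pi_lt_iff hδ]
    intro i
    rw [dist_comm, dist_eq_norm]
    exact hy i
  have hPz (k) : P * ((P - t (y 0)) * y k) = (P - t (y 0)) * y k := by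
    rw [← mul_assoc, mul_sub, hP, hPt]
  set z : Fin (q + 1) → A := fun k => (P - t (y 0)) * y k with hzdef
  refine ⟨Fin.cons (z 0 * P) fun i => a i.succ +
      (z (finProdFinEquiv.symm i).1.succ - x (finProdFinEquiv.symm i).1.succ) *
        U (finProdFinEquiv.symm i).2,
    Fin.cons (P * c 0 * P) fun i => V (finProdFinEquiv.symm i).2 *
      c (finProdFinEquiv.symm i).1.succ * P, ?_, ?_, ?_, ?_⟩
  · refine Fin.cases ?_ fun i => ?_
    · simp only [Set.mem_ofPred_eq, Fin.cons_zero]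
      rw [mul_assoc, mul_assoc, hP, ← mul_assoc, hPz]
    · simp only [Set.mem_ofPred_eq, Fin.cons_succ]
      rw [mul_add, add_mul, hPa, haP, ← mul_assoc, mul_sub, hPz, hPx, mul_assoc, hU]
  · refine Fin.cases ?_ fun i => ?_
    · simp only [Set.mem_ofPred_eq, Fin.cons_zero]
      rw [mul_assoc, mul_assoc, hP, ← mul_assoc, ← mul_assoc, hP]
    · simp only [Set.mem_ofPred_eq, Fin.cons_succ]
      rw [mul_assoc, mul_assoc, hP, ← mul_assoc, ← mul_assoc, hV]
  · refine Fin.cases ?_ fun i => ?_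
    · simpa using hy₀
    · simpa using hys (finProdFinEquiv.symm i).1 (finProdFinEquiv.symm i).2
  · have hblock (k : Fin q) : ∑ j, (a (finProdFinEquiv (k, j)).succ +
        (z k.succ - x k.succ) * U j) * (V j * c k.succ * P) = z k.succ * c k.succ * P := by
      calc _ = (∑ j, a (finProdFinEquiv (k, j)).succ * V j +
              (z k.succ - x k.succ) * ∑ j, U j * V j) * c k.succ * P := by
            simp only [Finset.mul_sum, ← Finset.sum_add_distrib, Finset.sum_mul, add_mul,
              mul_assoc]
        _ = (x k.succ + (z k.succ - x k.succ)) * c k.succ * P := by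
            rw [hUV, mul_one]; simp only [x, Fin.cons_succ]
        _ = z k.succ * c k.succ * P := by rw [add_sub_cancel]
    rw [Fin.sum_univ_succ]
    simp only [Fin.cons_zero, Fin.cons_succ]
    rw [← finProdFinEquiv.sum_comp, Fintype.sum_prod_type]
    simp only [Equiv.symm_apply_apply, hblock]
    have hfirst : z 0 * P * (P * c 0 * P) = z 0 * c 0 * P := by
      rw [← mul_assoc, ← mul_assoc, mul_assoc (z 0), hP, hzP]
    rw [hfirst, ← Fin.sum_univ_succ (fun k => z k * c k * P)]
    simp only [hzdef, mul_assoc, ← Finset.mul_sum]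
    simp only [← mul_assoc, ← Finset.sum_mul]
    rw [mul_assoc, hyc, one_mul, sub_mul, hP, htP, sub_zero]

/-- **Theorem (partial matrix algebras, lower bound).**  Let `A` be a unital
complex Banach algebra containing a set of `n × n` partial matrix units
`P_1, …, P_n`, `U_2, …, U_n`, `V_2, …, V_n` (indexed here by `Fin n` with
`P_1 = P (fin0 hn)`), and let `A_1 = P_1 A P_1`.  Then for every `p ≥ 1`, if
`Rg_p(A)` is dense in `A^p`, then `Rg_{(p−1)n+1}(A_1)` is dense in
`A_1^{(p−1)n+1}`; hence `rtsr(A_1) ≤ (rtsr(A) − 1)n + 1` and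
`⌈(rtsr(A_1) − 1)/n⌉ + 1 ≤ rtsr(A)`. -/
theorem rtsr_corner_of_partial_matrix_units
    {A : Type*} [NormedRing A] [NormedAlgebra ℂ A] [CompleteSpace A]
    (n : ℕ) (hn : 1 ≤ n) (P U V : Fin n → A)
    (hsum : ∑ i, P i = 1) (hidem : ∀ i, P i * P i = P i)
    (hU : ∀ i, i ≠ fin0 hn → U i = P i * U i * P (fin0 hn))
    (hV : ∀ i, i ≠ fin0 hn → V i = P (fin0 hn) * V i * P i)
    (hUV : ∀ i, i ≠ fin0 hn → U i * V i = P i)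
    (p : ℕ) (hp : 1 ≤ p)
    (hA : RgDenseInUnit (Set.univ : Set A) 1 p) :
    RgDenseInUnit {a : A | P (fin0 hn) * a * P (fin0 hn) = a}
      (P (fin0 hn)) ((p - 1) * n + 1) := by
  obtain ⟨q, rfl⟩ : ∃ q, p = q + 1 := ⟨p - 1, by omega⟩
  rw [Nat.add_sub_cancel]
  refine RgDenseInUnit.corner (U := Function.update U (fin0 hn) (P (fin0 hn)))
    (V := Function.update V (fin0 hn) (P (fin0 hn))) (hidem _) (fun j => ?_) (fun j => ?_) ?_ hA
  · rcases eq_or_ne j (fin0 hn) with rfl | hj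
    · simp [hidem]
    · rw [Function.update_of_ne hj, hU j hj, mul_assoc, hidem]
  · rcases eq_or_ne j (fin0 hn) with rfl | hj
    · simp [hidem]
    · rw [Function.update_of_ne hj, hV j hj, ← mul_assoc, ← mul_assoc, hidem]
  · rw [← hsum]
    refine Finset.sum_congr rfl fun j _ => ?_
    rcases eq_or_ne j (fin0 hn) with rfl | hj
    · simp [hidem]
    · rw [Function.update_of_ne hj, Function.update_of_ne hj, hUV j hj]
end
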